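/- arXiv:1807.05376 — 2 statements merged into one kernel-verified Lean document; each statement's English description precedes it below -/
import Mathlib

section
/- A 1-coloured graph (G,c) is generically isostatic in dimension 2 if and only if G is a Laman+1 graph and at least one edge of the colour class E_1 lies in the unique Laman-circuit subgraph of G. -/
open scoped RealInnerProductSpace

namespace CoordRigidity

variable {V : Type*} [Fintype V] [DecidableEq V] {d k : ℕ}

abbrev Cfg (V : Type*) (d : ℕ) := V → EuclideanSpace ℝ (Fin d)

/-- `p` is generic: its `d|V|` coordinates are algebraically independent over `ℚ`. -/
def Generic (p : Cfg V d) : Prop :=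
  AlgebraicIndependent ℚ (fun vi : V × Fin d => p vi.1 vi.2)

def FrameworkEquiv (G : SimpleGraph V) (p q : Cfg V d) : Prop :=
  ∀ i j, G.Adj i j → dist (p i) (p j) = dist (q i) (q j)

def Congruent (p q : Cfg V d) : Prop :=
  ∃ T : EuclideanSpace ℝ (Fin d) ≃ᵢ EuclideanSpace ℝ (Fin d), ∀ v, q v = T (p v)

def Rigid (G : SimpleGraph V) (p : Cfg V d) : Prop :=
  ∃ U ∈ nhds p, ∀ q ∈ U, FrameworkEquiv G p q → Congruent p q

def IsInfMotion (G : SimpleGraph V) (p p' : Cfg V d) : Prop :=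
  ∀ i j, G.Adj i j → ⟪p j - p i, p' j - p' i⟫ = 0

def IsTrivialMotion (p p' : Cfg V d) : Prop :=
  ∃ (S : Matrix (Fin d) (Fin d) ℝ) (t : Fin d → ℝ),
    S.transpose = -S ∧ ∀ v i, p' v i = (∑ j, S i j * p v j) + t i

def InfRigid (G : SimpleGraph V) (p : Cfg V d) : Prop :=
  ∀ p', IsInfMotion G p p' → IsTrivialMotion p p'

def FiniteMotion (G : SimpleGraph V) (p : Cfg V d) (P : ℝ → Cfg V d) : Prop :=
  ContinuousOn P (Set.Ico 0 1) ∧ P 0 = p ∧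
    ∀ t ∈ Set.Ico (0:ℝ) 1, FrameworkEquiv G p (P t)

def Flexible (G : SimpleGraph V) (p : Cfg V d) : Prop :=
  ∃ P, FiniteMotion G p P ∧ ∃ t ∈ Set.Ico (0:ℝ) 1, ¬ Congruent p (P t)

def IsEquilibriumLoad (p f : Cfg V d) : Prop :=
  (∑ i, f i) = 0 ∧
  ∀ j k : Fin d, j < k → (∑ i, (f i j * p i k - f i k * p i j)) = 0

def Resolves (G : SimpleGraph V) [DecidableRel G.Adj] (p : Cfg V d)
    (ρ : Sym2 V → ℝ) (f : Cfg V d) : Prop :=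
  ∀ i, (∑ j, if G.Adj i j then ρ s(i,j) • (p j - p i) else 0) = -f i

def IsEquilibriumStress (G : SimpleGraph V) [DecidableRel G.Adj] (p : Cfg V d)
    (ω : Sym2 V → ℝ) : Prop :=
  ∀ i, (∑ j, if G.Adj i j then ω s(i,j) • (p j - p i) else 0) = (0 : EuclideanSpace ℝ (Fin d))

/-- The row of the rigidity matrix corresponding to an edge. -/
noncomputable def rRow (p : Cfg V d) : Sym2 V → (V × Fin d → ℝ) :=
  Sym2.lift ⟨fun i j vk =>
      (if vk.1 = i then p i vk.2 - p j vk.2 else 0) +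
      (if vk.1 = j then p j vk.2 - p i vk.2 else 0),
    fun _ _ => funext fun _ => add_comm _ _⟩

noncomputable def coordRow (c : Sym2 V → Option (Fin k)) (p : Cfg V d) (e : Sym2 V) :
    (V × Fin d) ⊕ Fin k → ℝ :=
  Sum.elim (rRow p e) (fun ℓ => if c e = some ℓ then 1 else 0)

noncomputable def rowRank (p : Cfg V d) (F : Set (Sym2 V)) : ℕ :=
  Module.finrank ℝ ↥(Submodule.span ℝ (rRow p '' F))

def CoordEquiv (G : SimpleGraph V) (c : Sym2 V → Option (Fin k))
    (p : Cfg V d) (r : Fin k → ℝ) (q : Cfg V d) (s : Fin k → ℝ) : Prop :=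
  (∀ i j, G.Adj i j → c s(i,j) = none → dist (p i) (p j) = dist (q i) (q j)) ∧
  (∀ i j ℓ, G.Adj i j → c s(i,j) = some ℓ →
    dist (p i) (p j) + r ℓ = dist (q i) (q j) + s ℓ)

def CoordCongruent (G : SimpleGraph V) (c : Sym2 V → Option (Fin k))
    (p : Cfg V d) (r : Fin k → ℝ) (q : Cfg V d) (s : Fin k → ℝ) : Prop :=
  CoordEquiv G c p r q s ∧ Congruent p q

def CoordRigid (G : SimpleGraph V) (c : Sym2 V → Option (Fin k))
    (p : Cfg V d) (r : Fin k → ℝ) : Prop :=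
  ∃ U ∈ nhds (p, r), ∀ qs : Cfg V d × (Fin k → ℝ), qs ∈ U →
    CoordEquiv G c p r qs.1 qs.2 → CoordCongruent G c p r qs.1 qs.2

def IsCoordInfMotion (G : SimpleGraph V) (c : Sym2 V → Option (Fin k))
    (p : Cfg V d) (p' : Cfg V d) (r' : Fin k → ℝ) : Prop :=
  (∀ i j, G.Adj i j → c s(i,j) = none → ⟪p j - p i, p' j - p' i⟫ = 0) ∧
  (∀ i j ℓ, G.Adj i j → c s(i,j) = some ℓ → ⟪p j - p i, p' j - p' i⟫ + r' ℓ = 0)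

def CoordInfRigid (G : SimpleGraph V) (c : Sym2 V → Option (Fin k)) (p : Cfg V d) : Prop :=
  ∀ p' r', IsCoordInfMotion G c p p' r' → r' = 0 ∧ IsTrivialMotion p p'

def CoordFiniteMotion (G : SimpleGraph V) (c : Sym2 V → Option (Fin k))
    (p : Cfg V d) (r : Fin k → ℝ) (P : ℝ → Cfg V d) (R : ℝ → (Fin k → ℝ)) : Prop :=
  ContinuousOn (fun t => (P t, R t)) (Set.Ico 0 1) ∧ P 0 = p ∧ R 0 = r ∧
    ∀ t ∈ Set.Ico (0:ℝ) 1, CoordEquiv G c p r (P t) (R t)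

def CoordFlexible (G : SimpleGraph V) (c : Sym2 V → Option (Fin k))
    (p : Cfg V d) (r : Fin k → ℝ) : Prop :=
  ∃ P R, CoordFiniteMotion G c p r P R ∧
    ∃ t ∈ Set.Ico (0:ℝ) 1, ¬ CoordCongruent G c p r (P t) (R t)

/-- Combinatorial Laman-type notions, for a "subgraph" given by a vertex set `W`
and an edge set `E'`. -/
def support (E' : Set (Sym2 V)) : Set V := {v | ∃ e ∈ E', v ∈ e}

def edgesWithin (E' : Set (Sym2 V)) (W : Set V) : Set (Sym2 V) :=
  {e ∈ E' | ∀ v ∈ e, v ∈ W}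

def LamanSparseOn (W : Set V) (E' : Set (Sym2 V)) : Prop :=
  ∀ W' ⊆ W, 2 ≤ W'.ncard → (edgesWithin E' W').ncard ≤ 2 * W'.ncard - 3

def Sparse22On (W : Set V) (E' : Set (Sym2 V)) : Prop :=
  ∀ W' ⊆ W, 2 ≤ W'.ncard → (edgesWithin E' W').ncard ≤ 2 * W'.ncard - 2

def IsLamanOn (W : Set V) (E' : Set (Sym2 V)) : Prop :=
  LamanSparseOn W E' ∧ E'.ncard = 2 * W.ncard - 3

def IsLamanCircuitOn (W : Set V) (E' : Set (Sym2 V)) : Prop :=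
  E'.ncard = 2 * W.ncard - 2 ∧ ∀ e ∈ E', IsLamanOn W (E' \ {e})

def IsLamanPlusOne (G : SimpleGraph V) : Prop :=
  G.edgeSet.ncard = 2 * Fintype.card V - 2 ∧
    ∃ e ∈ G.edgeSet, IsLamanOn Set.univ (G.edgeSet \ {e})

def IsLamanPlusTwo (G : SimpleGraph V) : Prop :=
  G.edgeSet.ncard = 2 * Fintype.card V - 1 ∧
    ∃ e ∈ G.edgeSet, ∃ f ∈ G.edgeSet, e ≠ f ∧
      IsLamanOn Set.univ (G.edgeSet \ {e, f})

/-- An edge is redundant in the generic `d`-dimensional rigidity matroid of `G`. -/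
def RedundantSet (d : ℕ) (G : SimpleGraph V) (F : Set (Sym2 V)) : Prop :=
  ∀ p : Cfg V d, Generic p → rowRank p (G.edgeSet \ F) = rowRank p G.edgeSet

/-- `(G,c)` is generically independent in dimension `d`: for generic `p` the rows of the
coordinated rigidity matrix `R⁺(p)` are linearly independent. -/
def GenericallyIndependentCoord {V : Type*} [Fintype V] [DecidableEq V] {k : ℕ} (d : ℕ)
    (G : SimpleGraph V) (c : Sym2 V → Option (Fin k)) : Prop :=
  ∀ p : Cfg V d, Generic p →
    LinearIndependent ℝ (fun e : G.edgeSet => coordRow c p ↑e)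

/-- `(G,c)` is generically isostatic in dimension `d`: for generic `p` the rows of
`R⁺(p)` are linearly independent and the coordinated framework is infinitesimally
rigid. -/
def GenericallyIsostaticCoord {V : Type*} [Fintype V] [DecidableEq V] {k : ℕ} (d : ℕ)
    (G : SimpleGraph V) (c : Sym2 V → Option (Fin k)) : Prop :=
  ∀ p : Cfg V d, Generic p →
    LinearIndependent ℝ (fun e : G.edgeSet => coordRow c p ↑e) ∧ CoordInfRigid G c p

section PlaneStresses

variable {V : Type*}

/-- `p` has algebraically independent coordinates. -/
def GenericPlane (p : V → Fin 2 → ℝ) : Prop :=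
  AlgebraicIndependent ℚ (fun vi : V × Fin 2 => p vi.1 vi.2)

lemma GenericPlane.aeval_ne_zero {p : V → Fin 2 → ℝ} (hp : GenericPlane p)
    {P : MvPolynomial (V × Fin 2) ℚ} {q : V → Fin 2 → ℝ}
    (hq : MvPolynomial.aeval (fun vi : V × Fin 2 => q vi.1 vi.2) P ≠ 0) :
    MvPolynomial.aeval (fun vi : V × Fin 2 => p vi.1 vi.2) P ≠ 0 := by
  intro h
  have : P = 0 := hp (by simpa using h)
  exact hq (by simp [this])

lemma GenericPlane.injective {p : V → Fin 2 → ℝ} (hp : GenericPlane p) {a b : V} (hab : a ≠ b)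
    (k : Fin 2) : p a k ≠ p b k := fun h => by
  have := AlgebraicIndependent.injective hp (a₁ := (a, k)) (a₂ := (b, k)) h
  simp [hab] at this

lemma GenericPlane.not_collinear [DecidableEq V] {p : V → Fin 2 → ℝ} (hp : GenericPlane p)
    {a b c : V}
    (hab : a ≠ b) (hac : a ≠ c) (hbc : b ≠ c) :
    (p b 0 - p a 0) * (p c 1 - p a 1) - (p b 1 - p a 1) * (p c 0 - p a 0) ≠ 0 := by
  have h := hp.aeval_ne_zero
    (P := (MvPolynomial.X (b, 0) - MvPolynomial.X (a, 0)) *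
        (MvPolynomial.X (c, 1) - MvPolynomial.X (a, 1)) -
      (MvPolynomial.X (b, 1) - MvPolynomial.X (a, 1)) *
        (MvPolynomial.X (c, 0) - MvPolynomial.X (a, 0)))
    (q := fun v k => if v = b ∧ k = 0 ∨ v = c ∧ k = 1 then 1 else 0)
    (by simp [hab, hac, hbc, hbc.symm])
  simpa using h

variable [Fintype V]

lemma exists_genericPlane : ∃ p : V → Fin 2 → ℝ, GenericPlane p := by
  obtain ⟨s, hs⟩ := exists_isTranscendenceBasis ℚ ℝ
  have hinf : Infinite s := by
    by_contra hfin
    rw [not_infinite_iff_finite] at hfin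
    have halg := hs.isAlgebraic
    rw [Subtype.range_coe] at halg
    have hcount : Cardinal.mk (Algebra.adjoin ℚ s) ≤ Cardinal.aleph0 := by
      refine (Algebra.cardinalMk_adjoin_le ℚ s).trans ?_
      simp
    have := Algebra.IsAlgebraic.cardinalMk_le_max (Algebra.adjoin ℚ s) ℝ
    rw [max_eq_right hcount, Cardinal.mk_real] at this
    exact absurd this (not_le.mpr Cardinal.aleph0_lt_continuum)
  obtain ⟨f⟩ : Nonempty (V × Fin 2 ↪ s) := by
    exact ⟨((Fintype.equivFin (V × Fin 2)).toEmbedding.trans Fin.valEmbedding).trans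
      (Infinite.natEmbedding s)⟩
  exact ⟨fun v k => f (v, k), hs.1.comp f f.injective⟩

/-- The resultant force at each vertex of the edge weights `ω` on the planar framework `p`. -/
def force (p : V → Fin 2 → ℝ) : (Sym2 V → ℝ) →ₗ[ℝ] (V → Fin 2 → ℝ) where
  toFun ω v k := ∑ u, ω s(v, u) * (p v k - p u k)
  map_add' ω ω' := by
    ext v k
    simp [add_mul, Finset.sum_add_distrib]
  map_smul' t ω := by
    ext v k
    simp [Finset.mul_sum, mul_assoc]

lemma force_apply (p : V → Fin 2 → ℝ) (ω : Sym2 V → ℝ) (v : V) (k : Fin 2) :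
    force p ω v k = ∑ u, ω s(v, u) * (p v k - p u k) := rfl

lemma sum_force_eq_zero (p : V → Fin 2 → ℝ) (ω : Sym2 V → ℝ) (k : Fin 2) :
    ∑ v, force p ω v k = 0 := by
  have h : ∑ v, force p ω v k = -∑ v, force p ω v k := by
    simp only [force_apply]
    conv_lhs => rw [Finset.sum_comm]
    simp only [← Finset.sum_neg_distrib]
    refine Finset.sum_congr rfl fun v _ => Finset.sum_congr rfl fun u _ => ?_
    rw [Sym2.eq_swap]
    ring
  linarith

lemma sum_torque_eq_zero (p : V → Fin 2 → ℝ) (ω : Sym2 V → ℝ) :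
    ∑ v, (p v 0 * force p ω v 1 - p v 1 * force p ω v 0) = 0 := by
  have e : ∀ v, p v 0 * force p ω v 1 - p v 1 * force p ω v 0 =
      ∑ u, ω s(v, u) * (p v 1 * p u 0 - p v 0 * p u 1) := by
    intro v
    simp only [force_apply, Finset.mul_sum, ← Finset.sum_sub_distrib]
    exact Finset.sum_congr rfl fun u _ => by ring
  simp only [e]
  have h : ∑ v, ∑ u, ω s(v, u) * (p v 1 * p u 0 - p v 0 * p u 1) =
      -∑ v, ∑ u, ω s(v, u) * (p v 1 * p u 0 - p v 0 * p u 1) := by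
    conv_lhs => rw [Finset.sum_comm]
    simp only [← Finset.sum_neg_distrib]
    refine Finset.sum_congr rfl fun v _ => Finset.sum_congr rfl fun u _ => ?_
    rw [Sym2.eq_swap]
    ring
  linarith

/-- The edges of `F` carry no nonzero equilibrium stress of total `χ`-weight zero. -/
def StressFree (p : V → Fin 2 → ℝ) (χ : Sym2 V → ℚ) (F : Finset (Sym2 V)) : Prop :=
  ∀ ω : Sym2 V → ℝ, (∀ e ∉ F, ω e = 0) → force p ω = 0 → ∑ e, (χ e : ℝ) * ω e = 0 → ω = 0

lemma stressFree_zero {p : V → Fin 2 → ℝ} {F : Finset (Sym2 V)} :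
    StressFree p 0 F ↔ ∀ ω : Sym2 V → ℝ, (∀ e ∉ F, ω e = 0) → force p ω = 0 → ω = 0 := by
  simp [StressFree]

lemma StressFree.mono {p : V → Fin 2 → ℝ} {χ : Sym2 V → ℚ} {F F' : Finset (Sym2 V)}
    (h : StressFree p χ F) (hF : F' ⊆ F) : StressFree p χ F' :=
  fun ω h0 => h ω fun e he => h0 e fun h' => he (hF h')

variable [DecidableEq V]

/-- Equilibrium at all but three suitable coordinates forces equilibrium everywhere. -/
lemma force_eq_zero_of_pinned {p : V → Fin 2 → ℝ} {ω : Sym2 V → ℝ} {a b : V}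
    (hab : p a 0 ≠ p b 0)
    (h : ∀ v k, ¬(v = a ∨ v = b ∧ k = 1) → force p ω v k = 0) : force p ω = 0 := by
  have hne : a ≠ b := fun h => hab (by rw [h])
  have h0 : force p ω a 0 = 0 := by
    rw [← sum_force_eq_zero p ω 0, eq_comm]
    refine Finset.sum_eq_single a (fun v _ hv => h v 0 (by simp [hv])) (by simp)
  have h1 : force p ω a 1 + force p ω b 1 = 0 := by
    rw [← sum_force_eq_zero p ω 1, eq_comm, ← Finset.sum_pair (f := fun v => force p ω v 1) hne,
      eq_comm]
    refine Finset.sum_subset (Finset.subset_univ _) fun v _ hv => h v 1 ?_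
    simp only [Finset.mem_insert, Finset.mem_singleton] at hv
    tauto
  have h2 : p a 0 * force p ω a 1 + p b 0 * force p ω b 1 = 0 := by
    have hb : force p ω b 0 = 0 := h b 0 (by simp [hne.symm])
    have e := sum_torque_eq_zero p ω
    rw [← Finset.sum_subset (Finset.subset_univ {a, b}) (fun v _ hv => ?_),
      Finset.sum_pair hne] at e
    · simpa [h0, hb] using e
    · simp only [Finset.mem_insert, Finset.mem_singleton] at hv
      rw [h v 1 (by tauto), h v 0 (by tauto)]
      simp
  have h3 : force p ω b 1 = 0 := by
    have : (p a 0 - p b 0) * force p ω b 1 = 0 := by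
      linear_combination (p a 0) * h1 - h2
    exact (mul_eq_zero.mp this).resolve_left (sub_ne_zero.mpr hab)
  have h4 : force p ω a 1 = 0 := by linarith
  ext v k
  by_cases hv : v = a ∨ v = b ∧ k = 1
  · rcases hv with rfl | ⟨rfl, rfl⟩
    · fin_cases k
      · exact h0
      · exact h4
    · exact h3
  · exact h v k hv

/-- The weights `ω` with those of the edges at `v` replaced by `0`. -/
def awayFrom (v : V) (ω : Sym2 V → ℝ) : Sym2 V → ℝ := fun e => if v ∈ e then 0 else ω e

lemma force_awayFrom_self (p : V → Fin 2 → ℝ) (ω : Sym2 V → ℝ) (v : V) (k : Fin 2) :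
    force p (awayFrom v ω) v k = 0 := by
  simp [force_apply, awayFrom]

lemma force_awayFrom {p q : V → Fin 2 → ℝ} {v : V} (hpq : ∀ u, u ≠ v → p u = q u)
    (ω : Sym2 V → ℝ) {w : V} (hw : w ≠ v) (k : Fin 2) :
    force p (awayFrom v ω) w k = force q ω w k - ω s(w, v) * (q w k - q v k) := by
  rw [force_apply, force_apply, ← Finset.add_sum_erase _ _ (Finset.mem_univ v),
    ← Finset.add_sum_erase (a := v) Finset.univ (fun u => ω s(w, u) * (q w k - q u k))
      (Finset.mem_univ v)]
  have : ∑ u ∈ Finset.univ.erase v, awayFrom v ω s(w, u) * (p w k - p u k) =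
      ∑ u ∈ Finset.univ.erase v, ω s(w, u) * (q w k - q u k) := by
    refine Finset.sum_congr rfl fun u hu => ?_
    have hu := Finset.ne_of_mem_erase hu
    rw [hpq w hw, hpq u hu, awayFrom, if_neg]
    simp [hw.symm, hu.symm]
  rw [this]
  simp [awayFrom]

lemma force_single (p : V → Fin 2 → ℝ) {a b : V} (hab : a ≠ b) (w : V) (k : Fin 2) :
    force p (Pi.single s(a, b) 1) w k =
      (if w = a then p a k - p b k else 0) + (if w = b then p b k - p a k else 0) := by
  rw [force_apply]
  by_cases ha : w = a
  · subst ha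
    rw [Finset.sum_eq_single b]
    · simp [hab]
    · intro u _ hu
      rw [Pi.single_eq_of_ne, zero_mul]
      simp only [ne_eq, Sym2.eq_iff, not_or, not_and]
      exact ⟨fun _ => hu, fun h => absurd h hab⟩
    · simp
  · by_cases hb : w = b
    · subst hb
      rw [Finset.sum_eq_single a]
      · simp [Sym2.eq_swap, ha]
      · intro u _ hu
        rw [Pi.single_eq_of_ne, zero_mul]
        simp only [ne_eq, Sym2.eq_iff, not_or, not_and]
        exact ⟨fun h => absurd h ha, fun _ => hu⟩
      · simp
    · rw [Finset.sum_eq_zero]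
      · simp [ha, hb]
      · intro u _
        rw [Pi.single_eq_of_ne, zero_mul]
        simp [ha, hb]

lemma force_of_three {p : V → Fin 2 → ℝ} {ω : Sym2 V → ℝ} {v a b c : V}
    (hab : a ≠ b) (hac : a ≠ c) (hbc : b ≠ c)
    (h : ∀ u, u ≠ a → u ≠ b → u ≠ c → ω s(v, u) = 0) (k : Fin 2) :
    force p ω v k = ω s(v, a) * (p v k - p a k) + ω s(v, b) * (p v k - p b k) +
      ω s(v, c) * (p v k - p c k) := by
  rw [force_apply, ← Finset.sum_subset (Finset.subset_univ {a, b, c}) (fun u _ hu => ?_),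
    Finset.sum_insert (by simp [hab, hac]), Finset.sum_pair hbc, add_assoc]
  simp only [Finset.mem_insert, Finset.mem_singleton, not_or] at hu
  rw [h u hu.1 hu.2.1 hu.2.2, zero_mul]

/-- Replacing the star at a vertex of degree three by an equivalent weighted triangle on its
neighbours preserves equilibrium. -/
lemma force_star_triangle {p q : V → Fin 2 → ℝ} {ω : Sym2 V → ℝ} {v a b c : V}
    (hab : a ≠ b) (hac : a ≠ c) (hbc : b ≠ c) (hva : a ≠ v) (hvb : b ≠ v) (hvc : c ≠ v)
    (hpq : ∀ u, u ≠ v → p u = q u) (hω : force q ω = 0)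
    (h : ∀ u, u ≠ a → u ≠ b → u ≠ c → ω s(v, u) = 0) {x y z : ℝ}
    (ha : ∀ k, ω s(v, a) * (p a k - q v k) = x * (p a k - p b k) + z * (p a k - p c k))
    (hb : ∀ k, ω s(v, b) * (p b k - q v k) = x * (p b k - p a k) + y * (p b k - p c k))
    (hc : ∀ k, ω s(v, c) * (p c k - q v k) = y * (p c k - p b k) + z * (p c k - p a k)) :
    force p (awayFrom v ω + x • Pi.single s(a, b) 1 + y • Pi.single s(b, c) 1 +
      z • Pi.single s(a, c) 1) = 0 := by
  ext w k
  simp only [map_add, map_smul, Pi.add_apply, Pi.smul_apply, force_single p hab,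
    force_single p hbc, force_single p hac, Pi.zero_apply, smul_eq_mul]
  by_cases hw : w = v
  · subst hw
    simp [force_awayFrom_self, hva.symm, hvb.symm, hvc.symm]
  rw [force_awayFrom hpq ω hw, hω, Sym2.eq_swap, ← hpq w hw]
  by_cases h1 : w = a
  · subst h1
    have := ha k
    simp only [if_true, hab, hac, if_false, Pi.zero_apply]
    linarith
  by_cases h2 : w = b
  · subst h2
    have := hb k
    simp only [if_true, h1, hbc, if_false, Pi.zero_apply]
    linarith
  by_cases h3 : w = c
  · subst h3
    have := hc k
    simp only [if_true, h1, h2, if_false, Pi.zero_apply]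
    linarith
  · simp [h1, h2, h3, h w h1 h2 h3]

/-- Stress-freeness at one configuration implies stress-freeness at every generic one. -/
lemma GenericPlane.stressFree {p : V → Fin 2 → ℝ} (hp : GenericPlane p) {χ : Sym2 V → ℚ}
    {F : Finset (Sym2 V)} {q : V → Fin 2 → ℝ} (hq : StressFree q χ F) : StressFree p χ F := by
  let P : Matrix F ((V × Fin 2) ⊕ Unit) (MvPolynomial (V × Fin 2) ℚ) :=
    Matrix.of fun e => Sum.elim
      (fun vk => ∑ u, if s(vk.1, u) = (e : Sym2 V) then
        MvPolynomial.X (vk.1, vk.2) - MvPolynomial.X (u, vk.2) else 0)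
      (fun _ => MvPolynomial.C (χ e))
  let ev (r : V → Fin 2 → ℝ) : MvPolynomial (V × Fin 2) ℚ →+* ℝ :=
    (MvPolynomial.aeval (fun vi : V × Fin 2 => r vi.1 vi.2)).toRingHom
  let ext (x : F → ℝ) : Sym2 V → ℝ := fun e => if h : e ∈ F then x ⟨e, h⟩ else 0
  have sum_ext : ∀ (x : F → ℝ) (g : Sym2 V → ℝ), ∑ e, g e * ext x e = ∑ e : F, x e * g e := by
    intro x g
    rw [← Finset.sum_subset (Finset.subset_univ F) (fun e _ he => by simp [ext, he]),
      ← Finset.sum_coe_sort F]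
    exact Finset.sum_congr rfl fun e _ => by simp [ext, mul_comm]
  have hl : ∀ r (x : F → ℝ) v k,
      Matrix.vecMul x (P.map (ev r)) (Sum.inl (v, k)) = force r (ext x) v k := by
    intro r x v k
    simp only [Matrix.vecMul, dotProduct, Matrix.map_apply, P, Matrix.of_apply, Sum.elim_inl,
      force_apply]
    rw [← sum_ext x (fun e => ev r (∑ u, if s(v, u) = e then
        MvPolynomial.X (v, k) - MvPolynomial.X (u, k) else 0))]
    simp only [map_sum, Finset.sum_mul]
    rw [Finset.sum_comm]
    refine Finset.sum_congr rfl fun u _ => ?_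
    rw [Finset.sum_eq_single s(v, u)]
    · simp [ev, mul_comm]
    · intro e _ he
      simp [he.symm]
    · simp
  have hr : ∀ r (x : F → ℝ),
      Matrix.vecMul x (P.map (ev r)) (Sum.inr ()) = ∑ e, (χ e : ℝ) * ext x e := by
    intro r x
    rw [sum_ext]
    simp [Matrix.vecMul, dotProduct, P, ev]
  have key : ∀ r, StressFree r χ F ↔ ev r (P * P.transpose).det ≠ 0 := by
    intro r
    have hdet : ev r (P * P.transpose).det = (P.map (ev r) * (P.map (ev r)).transpose).det := by
      rw [RingHom.map_det]
      congr 1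
      simp [Matrix.map_mul, Matrix.transpose_map]
    rw [hdet, ne_eq, ← Matrix.exists_vecMul_eq_zero_iff]
    constructor
    · rintro h ⟨x, hx, hx0⟩
      apply hx
      have h1 : Matrix.vecMul x (P.map (ev r)) = 0 := by
        rw [← dotProduct_self_eq_zero]
        nth_rewrite 2 [← Matrix.mulVec_transpose]
        rw [Matrix.dotProduct_mulVec, Matrix.vecMul_vecMul, hx0, zero_dotProduct]
      have h2 := h (ext x) (fun e he => by simp [ext, he])
        (by ext v k; rw [← hl, h1]; rfl) (by rw [← hr r, h1]; rfl)
      funext e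
      simpa [ext] using congrFun h2 e
    · intro h ω h0 hω hχ
      by_contra hne
      apply h
      have he : ext (fun e : F => ω e) = ω := by
        funext e
        by_cases h : e ∈ F
        · simp [ext, h]
        · simp [ext, h, h0 e h]
      refine ⟨fun e => ω e, fun hz => hne ?_, ?_⟩
      · rw [← he, hz]
        funext e
        simp [ext]
      · rw [← Matrix.vecMul_vecMul]
        have : Matrix.vecMul (fun e : F => ω e) (P.map (ev r)) = 0 := by
          funext i
          rcases i with ⟨v, k⟩ | i
          · rw [hl, he, hω]; rfl
          · rw [hr, he, hχ]; rfl
        rw [this, Matrix.zero_vecMul]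
  rw [key] at hq ⊢
  exact hp.aeval_ne_zero hq

omit [Fintype V] in
lemma eq_zero_of_awayFrom_eq_zero {ω : Sym2 V → ℝ} {v : V} (h : awayFrom v ω = 0)
    (hv : ∀ u, ω s(v, u) = 0) : ω = 0 := by
  funext e
  by_cases he : v ∈ e
  · obtain ⟨u, rfl⟩ := he
    exact hv u
  · simpa [awayFrom, he] using congrFun h e

/-- The neighbours of `v` along edges of `F`. -/
def nbrs (F : Finset (Sym2 V)) (v : V) : Finset V := {u | s(v, u) ∈ F}

@[simp]
lemma mem_nbrs {F : Finset (Sym2 V)} {v u : V} : u ∈ nbrs F v ↔ s(v, u) ∈ F := by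
  simp [nbrs]

lemma force_eq_sum_nbrs {p : V → Fin 2 → ℝ} {ω : Sym2 V → ℝ} {F : Finset (Sym2 V)}
    (h0 : ∀ e ∉ F, ω e = 0) (v : V) (k : Fin 2) :
    force p ω v k = ∑ u ∈ nbrs F v, ω s(v, u) * (p v k - p u k) := by
  rw [force_apply, eq_comm]
  refine Finset.sum_subset (Finset.subset_univ _) fun u _ hu => ?_
  rw [h0 _ (by simpa using hu), zero_mul]

lemma eq_zero_of_not_collinear {a b c : Fin 2 → ℝ}
    (hd : (b 0 - a 0) * (c 1 - a 1) - (b 1 - a 1) * (c 0 - a 0) ≠ 0) {x y : ℝ}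
    (h : ∀ k, x * (b k - a k) + y * (c k - a k) = 0) : x = 0 ∧ y = 0 := by
  have h0 := h 0
  have h1 := h 1
  constructor
  · refine (mul_eq_zero.mp ?_).resolve_right hd
    linear_combination (c 1 - a 1) * h0 - (c 0 - a 0) * h1
  · refine (mul_eq_zero.mp ?_).resolve_right hd
    linear_combination (b 0 - a 0) * h1 - (b 1 - a 1) * h0

lemma GenericPlane.stress_eq_zero_of_card_nbrs_le_two {p : V → Fin 2 → ℝ} (hp : GenericPlane p)
    {ω : Sym2 V → ℝ} {F : Finset (Sym2 V)} (hF : ∀ e ∈ F, ¬e.IsDiag)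
    (h0 : ∀ e ∉ F, ω e = 0) (hω : force p ω = 0) {v : V} (hv : (nbrs F v).card ≤ 2) (u : V) :
    ω s(v, u) = 0 := by
  have hne : ∀ w ∈ nbrs F v, v ≠ w := fun w hw h => hF _ (mem_nbrs.mp hw) (by simp [h])
  have hs : ∀ k, ∑ u ∈ nbrs F v, ω s(v, u) * (p v k - p u k) = 0 := fun k => by
    rw [← force_eq_sum_nbrs h0, hω]; rfl
  suffices h : ∀ w ∈ nbrs F v, ω s(v, w) = 0 by
    by_cases hu : u ∈ nbrs F v
    · exact h u hu
    · exact h0 _ (by simpa using hu)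
  interval_cases hc : (nbrs F v).card
  · simp [Finset.card_eq_zero.mp hc]
  · obtain ⟨a, ha⟩ := Finset.card_eq_one.mp hc
    have hs0 := hs 0
    rw [ha] at hs0 hne ⊢
    simp only [Finset.sum_singleton, Finset.mem_singleton, forall_eq] at hs0 hne ⊢
    exact (mul_eq_zero.mp hs0).resolve_right (sub_ne_zero.mpr (hp.injective hne 0))
  · obtain ⟨a, b, hab, hN⟩ := Finset.card_eq_two.mp hc
    rw [hN] at hs hne ⊢
    simp only [Finset.sum_pair hab, Finset.mem_insert, Finset.mem_singleton, forall_eq_or_imp,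
      forall_eq] at hs hne ⊢
    exact eq_zero_of_not_collinear (hp.not_collinear hne.1 hne.2 hab)
      fun k => by linear_combination -hs k

section DegreeThree

variable {p : V → Fin 2 → ℝ} {ω : Sym2 V → ℝ} {v a b c : V}

lemma GenericPlane.exists_triangle_stress (hp : GenericPlane p)
    (hab : a ≠ b) (hac : a ≠ c) (hbc : b ≠ c) (hva : a ≠ v) (hvb : b ≠ v) (hvc : c ≠ v)
    (h : ∀ u, u ≠ a → u ≠ b → u ≠ c → ω s(v, u) = 0) (hω : force p ω = 0) :
    ∃ x y z : ℝ, force p (awayFrom v ω + x • Pi.single s(a, b) 1 + y • Pi.single s(b, c) 1 +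
      z • Pi.single s(a, c) 1) = 0 := by
  have h3 : ∀ k, ω s(v, a) * (p v k - p a k) + ω s(v, b) * (p v k - p b k) +
      ω s(v, c) * (p v k - p c k) = 0 := fun k => by
    rw [← force_of_three hab hac hbc h, hω]; rfl
  have hst := fun x y z => force_star_triangle (x := x) (y := y) (z := z)
    hab hac hbc hva hvb hvc (fun _ _ => rfl) hω h
  by_cases hk : ω s(v, a) + ω s(v, b) + ω s(v, c) = 0
  · obtain ⟨hb, hc⟩ := eq_zero_of_not_collinear (hp.not_collinear hab hac hbc)
      (x := ω s(v, b)) (y := ω s(v, c)) fun k => by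
        linear_combination (p v k - p a k) * hk - h3 k
    have ha : ω s(v, a) = 0 := by linarith
    exact ⟨0, 0, 0, hst 0 0 0 (by simp [ha]) (by simp [hb]) (by simp [hc])⟩
  · refine ⟨ω s(v, a) * ω s(v, b) / (ω s(v, a) + ω s(v, b) + ω s(v, c)),
      ω s(v, b) * ω s(v, c) / (ω s(v, a) + ω s(v, b) + ω s(v, c)),
      ω s(v, a) * ω s(v, c) / (ω s(v, a) + ω s(v, b) + ω s(v, c)), hst _ _ _ ?_ ?_ ?_⟩
    · intro k
      field_simp
      linear_combination -ω s(v, a) * h3 k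
    · intro k
      field_simp
      linear_combination -ω s(v, b) * h3 k
    · intro k
      field_simp
      linear_combination -ω s(v, c) * h3 k

lemma GenericPlane.stress_of_midpoint (hp : GenericPlane p)
    (hab : a ≠ b) (hac : a ≠ c) (hbc : b ≠ c) (hva : a ≠ v) (hvb : b ≠ v) (hvc : c ≠ v)
    (h : ∀ u, u ≠ a → u ≠ b → u ≠ c → ω s(v, u) = 0)
    (hω : force (Function.update p v fun k => (p a k + p b k) / 2) ω = 0) :
    ω s(v, b) = ω s(v, a) ∧ ω s(v, c) = 0 ∧
      force p (awayFrom v ω + (ω s(v, a) / 2) • Pi.single s(a, b) 1) = 0 := by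
  have h3 : ∀ k, ω s(v, a) * ((p a k + p b k) / 2 - p a k) +
      ω s(v, b) * ((p a k + p b k) / 2 - p b k) +
      ω s(v, c) * ((p a k + p b k) / 2 - p c k) = 0 := fun k => by
    have := force_of_three (p := Function.update p v fun k => (p a k + p b k) / 2)
      hab hac hbc h k
    simpa [hω, hva, hvb, hvc] using this.symm
  obtain ⟨hx, hc⟩ := eq_zero_of_not_collinear (hp.not_collinear hab hac hbc)
    (x := ω s(v, a) - ω s(v, b) + ω s(v, c)) (y := -2 * ω s(v, c)) fun k => by
      linear_combination 2 * h3 k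
  have hc : ω s(v, c) = 0 := by linarith
  have hb : ω s(v, b) = ω s(v, a) := by linarith
  refine ⟨hb, hc, ?_⟩
  have := force_star_triangle (p := p) (x := ω s(v, a) / 2) (y := 0) (z := 0)
    hab hac hbc hva hvb hvc (fun u hu => by simp [hu]) hω h
    (fun k => by simp; ring) (fun k => by simp [hb]; ring) (fun k => by simp [hc])
  simpa using this

lemma GenericPlane.stress_of_coincident (hp : GenericPlane p)
    (hab : a ≠ b) (hac : a ≠ c) (hbc : b ≠ c) (hva : a ≠ v) (hvb : b ≠ v) (hvc : c ≠ v)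
    (h : ∀ u, u ≠ a → u ≠ b → u ≠ c → ω s(v, u) = 0)
    (hω : force (Function.update p v (p a)) ω = 0) :
    ω s(v, b) = 0 ∧ ω s(v, c) = 0 ∧ force p (awayFrom v ω) = 0 := by
  have h3 : ∀ k, ω s(v, b) * (p a k - p b k) + ω s(v, c) * (p a k - p c k) = 0 := fun k => by
    have := force_of_three (p := Function.update p v (p a)) hab hac hbc h k
    simpa [hω, hva, hvb, hvc] using this.symm
  obtain ⟨hb, hc⟩ := eq_zero_of_not_collinear (hp.not_collinear hab hac hbc)
    (x := ω s(v, b)) (y := ω s(v, c)) fun k => by linear_combination -h3 k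
  refine ⟨hb, hc, ?_⟩
  have := force_star_triangle (p := p) (x := 0) (y := 0) (z := 0)
    hab hac hbc hva hvb hvc (fun u hu => by simp [hu]) hω h
    (fun k => by simp) (fun k => by simp [hb]) (fun k => by simp [hc])
  simpa using this

end DegreeThree

/-- Every set of at least two vertices spans at most `2n - 3` edges of `F`. -/
def LamanSparse (F : Finset (Sym2 V)) : Prop :=
  ∀ W : Finset V, 2 ≤ W.card → (F ∩ W.sym2).card + 3 ≤ 2 * W.card

lemma StressFree.lamanSparse {p : V → Fin 2 → ℝ} (hp : GenericPlane p) {F : Finset (Sym2 V)}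
    (h : StressFree p 0 F) : LamanSparse F := by
  intro W hW
  obtain ⟨a, ha, b, hb, hab⟩ := Finset.one_lt_card.mp hW
  let T : Finset (V × Fin 2) := (W ×ˢ Finset.univ) \ {(a, 0), (a, 1), (b, 1)}
  have hT : T.card + 3 = 2 * W.card := by
    have h3 : ({(a, 0), (a, 1), (b, 1)} : Finset (V × Fin 2)).card = 3 :=
      Finset.card_eq_three.mpr ⟨_, _, _, by simp, by simp, by simp [hab], rfl⟩
    have := Finset.card_sdiff_add_card_eq_card (s := {(a, 0), (a, 1), (b, 1)})
      (t := W ×ˢ (Finset.univ : Finset (Fin 2))) (by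
        intro x
        simp only [Finset.mem_insert, Finset.mem_singleton, Finset.mem_product]
        rintro (rfl | rfl | rfl) <;> simp [ha, hb])
    rw [h3, Finset.card_product, Finset.card_univ, Fintype.card_fin] at this
    change T.card + 3 = _ at this
    omega
  let A := F ∩ W.sym2
  let x : (A → ℝ) →ₗ[ℝ] (Sym2 V → ℝ) := Function.ExtendByZero.linearMap ℝ Subtype.val
  have hx : ∀ y : A → ℝ, ∀ e ∉ A, x y e = 0 := fun y e he => by
    simp only [x, Function.ExtendByZero.linearMap_apply]
    rw [Function.extend_apply']
    · rfl
    · rintro ⟨a, rfl⟩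
      exact he a.2
  let f : (A → ℝ) →ₗ[ℝ] (T → ℝ) :=
    { toFun := fun y t => force p (x y) t.1.1 t.1.2
      map_add' := fun y z => by ext; simp
      map_smul' := fun r y => by ext; simp }
  have hf : Function.Injective f := by
    rw [injective_iff_map_eq_zero]
    intro y hy
    have hpin : force p (x y) = 0 := by
      refine force_eq_zero_of_pinned (hp.injective hab 0) fun v k hvk => ?_
      by_cases hv : v ∈ W
      · have hmem : (v, k) ∈ T := by
          simp only [T, Finset.mem_sdiff, Finset.mem_product, hv, Finset.mem_univ, true_and,
            Finset.mem_insert, Finset.mem_singleton, Prod.mk.injEq]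
          revert hvk
          fin_cases k <;> simp +contextual
        exact congrFun hy ⟨(v, k), hmem⟩
      · rw [force_apply]
        refine Finset.sum_eq_zero fun u _ => ?_
        rw [hx y _ (by simp [A, hv]), zero_mul]
    have := stressFree_zero.mp h (x y) (fun e he => hx y e (by simp [A, he])) hpin
    funext e
    have he := congrFun this e
    simpa [x, Function.ExtendByZero.linearMap_apply, Subtype.val_injective.extend_apply]
      using he
  have := LinearMap.finrank_le_finrank_of_injective hf
  simp only [Module.finrank_fintype_fun_eq_card, Fintype.card_coe] at this
  change A.card + 3 ≤ _
  omega

section Combinatorics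

variable {V : Type*} [DecidableEq V]

lemma LamanSparse.mono {F F' : Finset (Sym2 V)} (h : LamanSparse F) (hF : F' ⊆ F) :
    LamanSparse F' := fun W hW =>
  (Nat.add_le_add_right (Finset.card_le_card (Finset.inter_subset_inter_right hF)) 3).trans
    (h W hW)

/-- The endpoints of the edges of `F`. -/
def vertices (F : Finset (Sym2 V)) : Finset V := F.biUnion Sym2.toFinset

lemma mem_vertices {F : Finset (Sym2 V)} {v : V} : v ∈ vertices F ↔ ∃ e ∈ F, v ∈ e := by
  simp [vertices]

lemma vertices_subset_iff {F : Finset (Sym2 V)} {W : Finset V} :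
    vertices F ⊆ W ↔ F ⊆ W.sym2 := by
  simp only [Finset.subset_iff, mem_vertices, Finset.mem_sym2_iff]
  exact ⟨fun h e he v hv => h ⟨e, he, hv⟩, fun h v ⟨e, he, hv⟩ => h he v hv⟩

lemma two_le_card_vertices {F : Finset (Sym2 V)} (hF : ∀ e ∈ F, ¬e.IsDiag) (h : F.Nonempty) :
    2 ≤ (vertices F).card := by
  obtain ⟨e, he⟩ := h
  rw [← Sym2.card_toFinset_of_not_isDiag e (hF e he)]
  exact Finset.card_le_card (Finset.subset_biUnion_of_mem Sym2.toFinset he)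

lemma LamanSparse.card_add_three_le {F : Finset (Sym2 V)} (h : LamanSparse F)
    (hF : ∀ e ∈ F, ¬e.IsDiag) (hne : F.Nonempty) : F.card + 3 ≤ 2 * (vertices F).card := by
  have := h (vertices F) (two_le_card_vertices hF hne)
  rwa [Finset.inter_eq_left.mpr (vertices_subset_iff.mp subset_rfl)] at this

lemma sum_card_filter_mem {F : Finset (Sym2 V)} (hF : ∀ e ∈ F, ¬e.IsDiag) :
    ∑ v ∈ vertices F, (F.filter (v ∈ ·)).card = 2 * F.card := by
  refine (Finset.sum_card_bipartiteAbove_eq_sum_card_bipartiteBelow (fun v e => v ∈ e)).trans ?_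
  have : ∀ e ∈ F, (Finset.bipartiteBelow (fun v e => v ∈ e) (vertices F) e).card = 2 := by
    intro e he
    rw [← Sym2.card_toFinset_of_not_isDiag e (hF e he)]
    congr 1
    ext v
    simp only [Finset.mem_bipartiteBelow, Sym2.mem_toFinset, mem_vertices]
    exact ⟨fun h => h.2, fun h => ⟨⟨e, he, h⟩, h⟩⟩
  rw [Finset.sum_congr rfl this, Finset.sum_const, smul_eq_mul, mul_comm]

lemma inter_sym2_eq_empty_of_card_le_one {F : Finset (Sym2 V)} (hF : ∀ e ∈ F, ¬e.IsDiag)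
    {W : Finset V} (hW : W.card ≤ 1) : F ∩ W.sym2 = ∅ := by
  rw [Finset.eq_empty_iff_forall_notMem]
  rintro e he
  rw [Finset.mem_inter] at he
  have h1 := vertices_subset_iff.mpr (Finset.singleton_subset_iff.mpr he.2)
  have h2 := two_le_card_vertices (F := {e}) (by simpa using hF e he.1) (by simp)
  have := Finset.card_le_card h1
  omega

end Combinatorics

lemma card_nbrs (F : Finset (Sym2 V)) (v : V) :
    (nbrs F v).card = (F.filter (v ∈ ·)).card := by
  refine Finset.card_bij (fun u _ => s(v, u)) ?_ ?_ ?_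
  · intro u hu
    simpa using hu
  · intro u _ w _ h
    exact Sym2.congr_right.mp h
  · intro e he
    simp only [Finset.mem_filter] at he
    obtain ⟨u, rfl⟩ := he.2
    exact ⟨u, by simpa using he.1, rfl⟩

lemma card_filter_add_card_nbrs (F : Finset (Sym2 V)) (v : V) :
    (F.filter (v ∉ ·)).card + (nbrs F v).card = F.card := by
  rw [card_nbrs, add_comm, Finset.card_filter_add_card_filter_not]

lemma exists_card_nbrs_le_three {F : Finset (Sym2 V)} (hF : ∀ e ∈ F, ¬e.IsDiag)
    (h : F.card + 2 ≤ 2 * (vertices F).card) :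
    ∃ v ∈ vertices F, 1 ≤ (nbrs F v).card ∧ (nbrs F v).card ≤ 3 := by
  by_contra! hcon
  have hpos : ∀ v ∈ vertices F, 1 ≤ (nbrs F v).card := fun v hv => by
    obtain ⟨e, he, u, rfl⟩ := mem_vertices.mp hv
    exact Finset.card_pos.mpr ⟨u, by simpa using he⟩
  have := Finset.card_nsmul_le_sum (vertices F) (fun v => (F.filter (v ∈ ·)).card) 4
    fun v hv => by rw [← card_nbrs]; exact hcon v hv (hpos v hv)
  rw [sum_card_filter_mem hF, smul_eq_mul] at this
  omega

section Combinatorics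

variable {V : Type*} [DecidableEq V]

lemma inter_sym2_inter (F : Finset (Sym2 V)) (S T : Finset V) :
    (F ∩ S.sym2) ∩ (F ∩ T.sym2) = F ∩ (S ∩ T).sym2 := by
  ext e
  simp only [Finset.mem_inter, Finset.mem_sym2_iff]
  grind

lemma inter_sym2_union_subset (F : Finset (Sym2 V)) (S T : Finset V) :
    (F ∩ S.sym2) ∪ (F ∩ T.sym2) ⊆ F ∩ (S ∪ T).sym2 := by
  rw [← Finset.inter_union_distrib_left]
  exact Finset.inter_subset_inter_left (Finset.union_subset
    (Finset.sym2_mono Finset.subset_union_left) (Finset.sym2_mono Finset.subset_union_right))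

lemma card_inter_sym2_add_le (F : Finset (Sym2 V)) (S T : Finset V) :
    (F ∩ S.sym2).card + (F ∩ T.sym2).card ≤
      (F ∩ (S ∪ T).sym2).card + (F ∩ (S ∩ T).sym2).card := by
  rw [← Finset.card_union_add_card_inter, inter_sym2_inter]
  exact Nat.add_le_add_right (Finset.card_le_card (inter_sym2_union_subset F S T)) _

lemma LamanSparse.exists_not_tight {F : Finset (Sym2 V)} (h : LamanSparse F)
    (hF : ∀ e ∈ F, ¬e.IsDiag) {X Y Z : Finset V} {a b c : V} (hab : a ≠ b)
    (hX : b ∈ X ∧ c ∈ X) (hY : a ∈ Y ∧ c ∈ Y) (hZ : a ∈ Z ∧ b ∈ Z)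
    (hXYZ : ∀ W ⊆ X ∪ Y ∪ Z, a ∈ W → b ∈ W → c ∈ W → (F ∩ W.sym2).card + 4 ≤ 2 * W.card) :
    (F ∩ X.sym2).card + 3 < 2 * X.card ∨ (F ∩ Y.sym2).card + 3 < 2 * Y.card ∨
      (F ∩ Z.sym2).card + 3 < 2 * Z.card := by
  by_contra! hcon
  obtain ⟨tX, tY, tZ⟩ := hcon
  have key : ∀ S T : Finset V, S ∪ T ⊆ X ∪ Y ∪ Z → a ∈ S ∪ T → b ∈ S ∪ T → c ∈ S ∪ T →
      2 * S.card ≤ (F ∩ S.sym2).card + 3 → 2 * T.card ≤ (F ∩ T.sym2).card + 3 →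
      (S ∩ T).card ≤ 1 := by
    intro S T hs ha hb hc hS hT
    by_contra! h2
    have h1 := h _ h2
    have h3 := hXYZ _ hs ha hb hc
    have h4 := card_inter_sym2_add_le F S T
    have h5 := Finset.card_union_add_card_inter S T
    omega
  have hXY := key X Y Finset.subset_union_left (by simp [hY]) (by simp [hX]) (by simp [hX]) tX tY
  have hXZ := key X Z (by grind) (by simp [hZ]) (by simp [hX]) (by simp [hX]) tX tZ
  have hYZ := key Y Z (by grind) (by simp [hZ]) (by simp [hZ]) (by simp [hY]) tY tZ
  have hdis : ∀ S T : Finset V, (S ∩ T).card ≤ 1 → Disjoint (F ∩ S.sym2) (F ∩ T.sym2) :=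
    fun S T hST => by
      rw [Finset.disjoint_iff_inter_eq_empty, inter_sym2_inter,
        inter_sym2_eq_empty_of_card_le_one hF hST]
  have e1 : (F ∩ X.sym2).card + (F ∩ Y.sym2).card + (F ∩ Z.sym2).card ≤
      (F ∩ (X ∪ Y ∪ Z).sym2).card := by
    rw [← Finset.card_union_of_disjoint (hdis _ _ hXY), ← Finset.card_union_of_disjoint
      (Finset.disjoint_union_left.mpr ⟨hdis _ _ hXZ, hdis _ _ hYZ⟩)]
    exact Finset.card_le_card ((Finset.union_subset_union_left
      (inter_sym2_union_subset F X Y)).trans (inter_sym2_union_subset F (X ∪ Y) Z))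
  have c1 := Finset.card_union_add_card_inter X Y
  have p1 : 0 < (X ∩ Y).card := Finset.card_pos.mpr ⟨c, by simp [hX, hY]⟩
  have c2 := Finset.card_union_add_card_inter (X ∪ Y) Z
  have p2 : 1 < ((X ∪ Y) ∩ Z).card :=
    Finset.one_lt_card.mpr ⟨a, by simp [hY, hZ], b, by simp [hX, hZ], hab⟩
  have hU := hXYZ (X ∪ Y ∪ Z) subset_rfl (by simp [hZ]) (by simp [hZ]) (by simp [hX])
  omega

lemma LamanSparse.insert_of_not_tight {F : Finset (Sym2 V)} (h : LamanSparse F)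
    {v a b : V} (hab : a ≠ b) (hav : a ≠ v) (hbv : b ≠ v) (hv : ∀ e ∈ F, v ∉ e)
    (hW : ∀ W : Finset V, a ∈ W → b ∈ W → v ∉ W → (F ∩ W.sym2).card + 3 < 2 * W.card) :
    s(a, b) ∉ F ∧ LamanSparse (insert s(a, b) F) := by
  constructor
  · intro hmem
    have h1 := hW {a, b} (by simp) (by simp) (by simp [hav.symm, hbv.symm])
    rw [Finset.card_pair hab] at h1
    have : 0 < (F ∩ ({a, b} : Finset V).sym2).card :=
      Finset.card_pos.mpr ⟨s(a, b), by simp [hmem]⟩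
    omega
  · intro W h2
    by_cases hmem : a ∈ W ∧ b ∈ W
    · have hWv : F ∩ W.sym2 = F ∩ (W.erase v).sym2 := by
        ext e
        simp only [Finset.mem_inter, Finset.mem_sym2_iff, Finset.mem_erase]
        exact ⟨fun h => ⟨h.1, fun x hx => ⟨fun hxv => hv e h.1 (hxv ▸ hx), h.2 x hx⟩⟩,
          fun h => ⟨h.1, fun x hx => (h.2 x hx).2⟩⟩
      have h1 := hW (W.erase v) (by simp [hav, hmem.1]) (by simp [hbv, hmem.2]) (by simp)
      have h3 : (W.erase v).card ≤ W.card := Finset.card_erase_le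
      have h4 := Finset.card_insert_le s(a, b) (F ∩ W.sym2)
      have h5 : insert s(a, b) F ∩ W.sym2 ⊆ insert s(a, b) (F ∩ W.sym2) := by
        rw [Finset.insert_inter_distrib]
        exact Finset.inter_subset_inter_left (Finset.subset_insert _ _)
      have := Finset.card_le_card h5
      rw [hWv] at h4 this
      omega
    · have : insert s(a, b) F ∩ W.sym2 = F ∩ W.sym2 :=
        Finset.insert_inter_of_notMem (by simpa using hmem)
      rw [this]
      exact h W h2

end Combinatorics

lemma LamanSparse.exists_insert {F : Finset (Sym2 V)} (h : LamanSparse F)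
    (hF : ∀ e ∈ F, ¬e.IsDiag) {v a b c : V} (hab : a ≠ b) (hac : a ≠ c) (hbc : b ≠ c)
    (hN : nbrs F v = {a, b, c}) :
    ∃ x y z, nbrs F v = {x, y, z} ∧ x ≠ y ∧ x ≠ z ∧ y ≠ z ∧ s(x, y) ∉ F.filter (v ∉ ·) ∧
      LamanSparse (insert s(x, y) (F.filter (v ∉ ·))) := by
  have hne : ∀ u ∈ nbrs F v, u ≠ v := fun u hu huv => hF _ (mem_nbrs.mp hu) (by simp [huv])
  simp only [hN, Finset.mem_insert, Finset.mem_singleton, forall_eq_or_imp, forall_eq] at hne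
  obtain ⟨hav, hbv, hcv⟩ := hne
  set L := F.filter (v ∉ ·) with hL
  have hLF : L ⊆ F := Finset.filter_subset _ _
  have hLv : ∀ e ∈ L, v ∉ e := fun e he => (Finset.mem_filter.mp he).2
  have hthree : ∀ W : Finset V, v ∉ W → a ∈ W → b ∈ W → c ∈ W →
      (L ∩ W.sym2).card + 4 ≤ 2 * W.card := by
    intro W hvW ha hb hc
    have hcard : (F ∩ (insert v W).sym2).card = (L ∩ W.sym2).card + 3 := by
      rw [← card_filter_add_card_nbrs _ v]
      congr 1
      · congr 1
        ext e
        simp only [hL, Finset.mem_filter, Finset.mem_inter, Finset.mem_sym2_iff,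
          Finset.mem_insert]
        grind
      · have : nbrs (F ∩ (insert v W).sym2) v = {a, b, c} := by
          rw [← hN]
          ext u
          have hu : u ∈ nbrs F v → u ∈ W := by
            rw [hN]
            simp only [Finset.mem_insert, Finset.mem_singleton]
            rintro (rfl | rfl | rfl) <;> assumption
          rw [mem_nbrs] at hu
          simp only [mem_nbrs, Finset.mem_inter, Finset.mk_mem_sym2_iff, Finset.mem_insert]
          grind
        rw [this, Finset.card_eq_three.mpr ⟨a, b, c, hab, hac, hbc, rfl⟩]
    have h1 := h (insert v W) (by
      rw [Finset.card_insert_of_notMem hvW]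
      have := Finset.card_pos.mpr ⟨a, ha⟩
      omega)
    rw [hcard, Finset.card_insert_of_notMem hvW] at h1
    omega
  have hLs := h.mono hLF
  by_contra! hcon
  have aux : ∀ x y z, nbrs F v = {x, y, z} → x ≠ y → x ≠ z → y ≠ z → x ≠ v → y ≠ v →
      ∃ W : Finset V, x ∈ W ∧ y ∈ W ∧ v ∉ W ∧ 2 * W.card ≤ (L ∩ W.sym2).card + 3 := by
    intro x y z hN hxy hxz hyz hxv hyv
    by_contra! hW
    obtain ⟨h1, h2⟩ := hLs.insert_of_not_tight hxy hxv hyv hLv hW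
    exact hcon x y z hN hxy hxz hyz h1 h2
  obtain ⟨Z, haZ, hbZ, hvZ, tZ⟩ := aux a b c hN hab hac hbc hav hbv
  obtain ⟨Y, haY, hcY, hvY, tY⟩ := aux a c b (by rw [hN]; grind) hac hab hbc.symm hav hcv
  obtain ⟨X, hbX, hcX, hvX, tX⟩ := aux b c a (by rw [hN]; grind) hbc hab.symm hac.symm hbv hcv
  have := hLs.exists_not_tight (fun e he => hF e (hLF he)) hab ⟨hbX, hcX⟩ ⟨haY, hcY⟩ ⟨haZ, hbZ⟩
    fun W hW => hthree W fun hvW => by simpa [hvX, hvY, hvZ] using hW hvW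
  omega

lemma StressFree.of_card_nbrs_le_two {p : V → Fin 2 → ℝ} (hp : GenericPlane p)
    {F : Finset (Sym2 V)} (hF : ∀ e ∈ F, ¬e.IsDiag) {v : V} (hv : (nbrs F v).card ≤ 2)
    (h : StressFree p 0 (F.filter (v ∉ ·))) : StressFree p 0 F := by
  rw [stressFree_zero] at h ⊢
  intro ω h0 hω
  have hz := hp.stress_eq_zero_of_card_nbrs_le_two hF h0 hω hv
  have haway : awayFrom v ω = ω := by
    funext e
    by_cases he : v ∈ e
    · obtain ⟨u, rfl⟩ := he
      simp [awayFrom, hz]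
    · simp [awayFrom, he]
  refine eq_zero_of_awayFrom_eq_zero ?_ hz
  rw [haway]
  refine h ω (fun e he => ?_) hω
  by_cases hve : v ∈ e
  · obtain ⟨u, rfl⟩ := hve
    exact hz u
  · exact h0 e fun heF => he (Finset.mem_filter.mpr ⟨heF, hve⟩)

lemma StressFree.of_insert {p : V → Fin 2 → ℝ} (hp : GenericPlane p) {F : Finset (Sym2 V)}
    (hF : ∀ e ∈ F, ¬e.IsDiag) {v a b c : V} (hN : nbrs F v = {a, b, c}) (hab : a ≠ b)
    (hac : a ≠ c) (hbc : b ≠ c) (hmem : s(a, b) ∉ F.filter (v ∉ ·))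
    (h : StressFree p 0 (insert s(a, b) (F.filter (v ∉ ·)))) : StressFree p 0 F := by
  have hne : ∀ u ∈ nbrs F v, u ≠ v := fun u hu huv => hF _ (mem_nbrs.mp hu) (by simp [huv])
  simp only [hN, Finset.mem_insert, Finset.mem_singleton, forall_eq_or_imp, forall_eq] at hne
  obtain ⟨hav, hbv, hcv⟩ := hne
  refine hp.stressFree (q := Function.update p v fun k => (p a k + p b k) / 2) ?_
  rw [stressFree_zero] at h ⊢
  intro ω h0 hω
  have hz : ∀ u, u ≠ a → u ≠ b → u ≠ c → ω s(v, u) = 0 := fun u h1 h2 h3 =>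
    h0 _ fun hu => by
      have := mem_nbrs.mpr hu
      simp [hN, h1, h2, h3] at this
  obtain ⟨h1, h2, h3⟩ := hp.stress_of_midpoint hab hac hbc hav hbv hcv hz hω
  have h4 := h _ (fun e he => ?_) h3
  · have hab0 := congrFun h4 s(a, b)
    have hzero : awayFrom v ω s(a, b) = 0 := by
      by_cases hve : v ∈ s(a, b)
      · simp [awayFrom, hve]
      · simp only [awayFrom, hve, if_false]
        exact h0 _ fun hh => hmem (Finset.mem_filter.mpr ⟨hh, hve⟩)
    simp only [Pi.add_apply, Pi.smul_apply, Pi.single_eq_same, hzero, smul_eq_mul, mul_one,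
      zero_add, Pi.zero_apply] at hab0
    refine eq_zero_of_awayFrom_eq_zero (v := v) ?_ fun u => ?_
    · simpa [hab0] using h4
    · have ha : ω s(v, a) = 0 := by linarith
      by_cases hua : u = a
      · rwa [hua]
      by_cases hub : u = b
      · rw [hub, h1, ha]
      by_cases huc : u = c
      · rw [huc, h2]
      exact hz u hua hub huc
  · simp only [Finset.mem_insert, not_or, Finset.mem_filter, not_and, not_not] at he
    have hs : (Pi.single s(a, b) 1 : Sym2 V → ℝ) e = 0 := Pi.single_eq_of_ne he.1 _
    simp only [Pi.add_apply, Pi.smul_apply, hs, smul_zero, add_zero]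
    by_cases hve : v ∈ e
    · simp [awayFrom, hve]
    · simp only [awayFrom, hve, if_false]
      exact h0 _ fun hh => hve (he.2 hh)

/-- Sufficiency in Laman's theorem. -/
theorem LamanSparse.stressFree {p : V → Fin 2 → ℝ} (hp : GenericPlane p) {F : Finset (Sym2 V)}
    (hF : ∀ e ∈ F, ¬e.IsDiag) (h : LamanSparse F) : StressFree p 0 F := by
  induction hn : F.card using Nat.strong_induction_on generalizing F with
  | _ n ih =>
  subst hn
  obtain rfl | hne := F.eq_empty_or_nonempty
  · exact fun ω h0 _ _ => funext fun e => h0 e (by simp)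
  have hcard := h.card_add_three_le hF hne
  obtain ⟨v, -, h1, h3⟩ := exists_card_nbrs_le_three hF (by omega)
  have hsum := card_filter_add_card_nbrs F v
  have hsub : F.filter (v ∉ ·) ⊆ F := Finset.filter_subset _ _
  obtain h2 | h3 : (nbrs F v).card ≤ 2 ∨ (nbrs F v).card = 3 := by omega
  · exact StressFree.of_card_nbrs_le_two hp hF h2
      (ih _ (by omega) (fun e he => hF e (hsub he)) (h.mono hsub) rfl)
  · obtain ⟨a, b, c, hab, hac, hbc, hN⟩ := Finset.card_eq_three.mp h3
    obtain ⟨x, y, z, hN, hxy, hxz, hyz, hmem, hins⟩ := h.exists_insert hF hab hac hbc hN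
    refine StressFree.of_insert hp hF hN hxy hxz hyz hmem (ih _ ?_ ?_ hins rfl)
    · rw [Finset.card_insert_of_notMem hmem]
      omega
    · intro e he
      obtain rfl | he := Finset.mem_insert.mp he
      · simpa using hxy
      · exact hF e (hsub he)

omit [Fintype V] in
lemma card_add_two_eq_of_circuit {C : Finset (Sym2 V)} (hF : ∀ e ∈ C, ¬e.IsDiag)
    (hC : ¬LamanSparse C) (h : ∀ e ∈ C, LamanSparse (C.erase e)) :
    C.card + 2 = 2 * (vertices C).card := by
  unfold LamanSparse at hC
  push Not at hC
  obtain ⟨W, h2, hW⟩ := hC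
  have hCW : C ⊆ W.sym2 := by
    intro e he
    by_contra heW
    have h1 := h e he W h2
    rw [Finset.erase_inter, Finset.erase_eq_of_notMem (by simp [heW])] at h1
    omega
  rw [Finset.inter_eq_left.mpr hCW] at hW
  obtain ⟨e, he⟩ : C.Nonempty := Finset.card_pos.mp (by omega)
  have hle := Finset.card_le_card (vertices_subset_iff.mpr hCW)
  have h1 := h e he (vertices C) (two_le_card_vertices hF ⟨e, he⟩)
  rw [Finset.inter_eq_left.mpr
    ((Finset.erase_subset e C).trans (vertices_subset_iff.mp subset_rfl)),
    Finset.card_erase_of_mem he] at h1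
  omega

section CircuitStep

variable {p : V → Fin 2 → ℝ} {χ : Sym2 V → ℚ} {C L : Finset (Sym2 V)} {v a b c : V}

omit [Fintype V] in
lemma awayFrom_eq_zero_of_notMem {ω : Sym2 V → ℝ} (h0 : ∀ e ∉ C, ω e = 0) {e : Sym2 V}
    (he : e ∉ C.filter (v ∉ ·)) : awayFrom v ω e = 0 := by
  by_cases hve : v ∈ e
  · simp [awayFrom, hve]
  · simp only [awayFrom, hve, if_false]
    exact h0 _ fun hh => he (Finset.mem_filter.mpr ⟨hh, hve⟩)

lemma StressFree.of_spoke (hp : GenericPlane p) (hF : ∀ e ∈ C, ¬e.IsDiag)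
    (hN : nbrs C v = {a, b, c}) (hab : a ≠ b) (hac : a ≠ c) (hbc : b ≠ c)
    (hL : StressFree p 0 (C.filter (v ∉ ·))) (hχ : χ s(v, a) ≠ 0) : StressFree p χ C := by
  have hne : ∀ u ∈ nbrs C v, u ≠ v := fun u hu huv => hF _ (mem_nbrs.mp hu) (by simp [huv])
  simp only [hN, Finset.mem_insert, Finset.mem_singleton, forall_eq_or_imp, forall_eq] at hne
  obtain ⟨hav, hbv, hcv⟩ := hne
  refine hp.stressFree (q := Function.update p v (p a)) fun ω h0 hω hsum => ?_
  have hz : ∀ u, u ≠ a → u ≠ b → u ≠ c → ω s(v, u) = 0 := fun u h1 h2 h3 =>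
    h0 _ fun hu => by
      have := mem_nbrs.mpr hu
      simp [hN, h1, h2, h3] at this
  obtain ⟨h1, h2, h3⟩ := hp.stress_of_coincident hab hac hbc hav hbv hcv hz hω
  have haway := stressFree_zero.mp hL _ (fun e he => awayFrom_eq_zero_of_notMem h0 he) h3
  have hspoke : ∀ u, u ≠ a → ω s(v, u) = 0 := fun u hu => by
    by_cases hub : u = b
    · rw [hub, h1]
    by_cases huc : u = c
    · rw [huc, h2]
    exact hz u hu hub huc
  rw [Finset.sum_eq_single s(v, a)] at hsum
  · refine eq_zero_of_awayFrom_eq_zero haway fun u => ?_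
    by_cases hu : u = a
    · rw [hu]
      exact (mul_eq_zero.mp hsum).resolve_left (by exact_mod_cast hχ)
    · exact hspoke u hu
  · intro e _ he
    by_cases hve : v ∈ e
    · obtain ⟨u, rfl⟩ := hve
      rw [hspoke u fun h => he (by rw [h]), mul_zero]
    · have := congrFun haway e
      simp only [awayFrom, hve, if_false, Pi.zero_apply] at this
      rw [this, mul_zero]
  · simp

lemma StressFree.of_chord (hp : GenericPlane p) (hF : ∀ e ∈ C, ¬e.IsDiag)
    (hN : nbrs C v = {a, b, c}) (hab : a ≠ b) (hac : a ≠ c) (hbc : b ≠ c)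
    (hL : StressFree p 0 (C.filter (v ∉ ·))) (hχ : ∀ u, s(v, u) ∈ C → χ s(v, u) = 0)
    {s : Sym2 V → ℝ}
    (hs : ∀ e ∉ C.filter (v ∉ ·), s e = 0)
    (hforce : force p (Pi.single s(a, b) 1) = force p s)
    (hsum : ∑ e, (χ e : ℝ) * s e ≠ 0) : StressFree p χ C := by
  have hne : ∀ u ∈ nbrs C v, u ≠ v := fun u hu huv => hF _ (mem_nbrs.mp hu) (by simp [huv])
  simp only [hN, Finset.mem_insert, Finset.mem_singleton, forall_eq_or_imp, forall_eq] at hne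
  obtain ⟨hav, hbv, hcv⟩ := hne
  refine hp.stressFree (q := Function.update p v fun k => (p a k + p b k) / 2)
    fun ω h0 hω hω0 => ?_
  have hz : ∀ u, u ≠ a → u ≠ b → u ≠ c → ω s(v, u) = 0 := fun u h1 h2 h3 =>
    h0 _ fun hu => by
      have := mem_nbrs.mpr hu
      simp [hN, h1, h2, h3] at this
  obtain ⟨h1, h2, h3⟩ := hp.stress_of_midpoint hab hac hbc hav hbv hcv hz hω
  have haway : awayFrom v ω + (ω s(v, a) / 2) • s = 0 := by
    refine stressFree_zero.mp hL _ (fun e he => ?_) ?_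
    · simp [awayFrom_eq_zero_of_notMem h0 he, hs e he]
    · rw [map_add, map_smul, ← hforce, ← map_smul, ← map_add, h3]
  have hsω : ∑ e, (χ e : ℝ) * ω e = -(ω s(v, a) / 2) * ∑ e, (χ e : ℝ) * s e := by
    rw [Finset.mul_sum]
    refine Finset.sum_congr rfl fun e _ => ?_
    by_cases hve : v ∈ e
    · obtain ⟨u, rfl⟩ := hve
      by_cases hu : s(v, u) ∈ C
      · simp [hχ u hu]
      · simp [h0 _ hu, hs _ fun h => hu (Finset.mem_filter.mp h).1]
    · have := congrFun haway e
      simp only [awayFrom, Pi.add_apply, hve, if_false, Pi.smul_apply, smul_eq_mul,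
        Pi.zero_apply] at this
      linear_combination (χ e : ℝ) * this
  rw [hsω] at hω0
  have ha : ω s(v, a) = 0 := by
    have := (mul_eq_zero.mp hω0).resolve_right hsum
    linarith
  refine eq_zero_of_awayFrom_eq_zero (v := v) ?_ fun u => ?_
  · simpa [ha] using haway
  · by_cases hua : u = a
    · rwa [hua]
    by_cases hub : u = b
    · rw [hub, h1, ha]
    by_cases huc : u = c
    · rw [huc, h2]
    exact hz u hua hub huc

lemma StressFree.exists_chord_stress (hp : GenericPlane p) (hL : StressFree p 0 L)
    {W : Finset V} (hLW : L ⊆ W.sym2) (hcard : 2 * W.card ≤ L.card + 3) (hab : a ≠ b)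
    (ha : a ∈ W) (hb : b ∈ W) :
    ∃ s : Sym2 V → ℝ, (∀ e ∉ L, s e = 0) ∧ force p (Pi.single s(a, b) 1) = force p s := by
  by_cases hmem : s(a, b) ∈ L
  · exact ⟨Pi.single s(a, b) 1, fun e he => Pi.single_eq_of_ne (by grind) _, rfl⟩
  have hnot : ¬StressFree p 0 (insert s(a, b) L) := fun h => by
    have h1 := h.lamanSparse hp W (Finset.one_lt_card.mpr ⟨a, ha, b, hb, hab⟩)
    rw [Finset.inter_eq_left.mpr (Finset.insert_subset (by simp [ha, hb]) hLW),
      Finset.card_insert_of_notMem hmem] at h1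
    omega
  rw [stressFree_zero] at hnot hL
  push Not at hnot
  obtain ⟨ν, h0, hν, hne⟩ := hnot
  have hx : ν s(a, b) ≠ 0 := fun hx => hne <| hL ν (fun e he => by
    by_cases h : e = s(a, b)
    · rw [h, hx]
    · exact h0 e (by simp [h, he])) hν
  refine ⟨Pi.single s(a, b) 1 - (ν s(a, b))⁻¹ • ν, fun e he => ?_, ?_⟩
  · by_cases h : e = s(a, b)
    · simp [h, hx]
    · simp [h, h0 e (by simp [h, he])]
  · rw [map_sub, map_smul, hν, smul_zero, sub_zero]

omit [DecidableEq V] in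
lemma StressFree.eq_of_force_eq (hL : StressFree p 0 L) {s t : Sym2 V → ℝ}
    (hs : ∀ e ∉ L, s e = 0) (ht : ∀ e ∉ L, t e = 0) (h : force p s = force p t) : s = t :=
  sub_eq_zero.mp <| stressFree_zero.mp hL _ (fun e he => by simp [hs e he, ht e he])
    (by rw [map_sub, h, sub_self])

end CircuitStep

/-- The support of the stress created by adding one edge to a stress-free set is a circuit. -/
lemma StressFree.erase_support {p : V → Fin 2 → ℝ} {L : Finset (Sym2 V)} (hL : StressFree p 0 L)
    {η : Sym2 V → ℝ} {f : Sym2 V} (hη0 : ∀ e ∉ insert f L, η e = 0) (hf : η f ≠ 0)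
    (hη : force p η = 0) {e : Sym2 V} (he : η e ≠ 0) :
    StressFree p 0 ((Finset.univ.filter (η · ≠ 0)).erase e) := by
  rw [stressFree_zero]
  intro ν hν0 hν
  have hprop : ν - (ν f / η f) • η = 0 := by
    refine stressFree_zero.mp hL _ (fun g hg => ?_) ?_
    · by_cases hgf : g = f
      · simp [hgf, hf]
      · have hgη : η g = 0 := hη0 g (by simp [hgf, hg])
        simp [hgη, hν0 g (by simp [hgη])]
    · rw [map_sub, map_smul, hν, hη, smul_zero, sub_zero]
  have hνe := congrFun hprop e
  simp only [Pi.sub_apply, hν0 e (Finset.notMem_erase _ _), Pi.smul_apply, smul_eq_mul,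
    zero_sub, Pi.zero_apply, neg_eq_zero] at hνe
  simpa [(mul_eq_zero.mp hνe).resolve_right he] using hprop

/-- If a colour function does not vanish on a circuit, then it kills the stress of the circuit. -/
theorem GenericPlane.stressFree_of_circuit {p : V → Fin 2 → ℝ} (hp : GenericPlane p)
    {C : Finset (Sym2 V)} (hF : ∀ e ∈ C, ¬e.IsDiag) {ω : Sym2 V → ℝ}
    (h0 : ∀ e, ω e ≠ 0 ↔ e ∈ C) (hω : force p ω = 0)
    (herase : ∀ e ∈ C, StressFree p 0 (C.erase e)) {χ : Sym2 V → ℚ} {e₀ : Sym2 V}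
    (he₀ : e₀ ∈ C) (hχ : χ e₀ ≠ 0) : StressFree p χ C := by
  induction hn : C.card using Nat.strong_induction_on generalizing C ω χ e₀ with
  | _ n ih =>
  subst hn
  have h0' : ∀ e ∉ C, ω e = 0 := fun e he => by simpa [he] using h0 e
  have hcard := card_add_two_eq_of_circuit hF
    (fun h => (h0 e₀).mpr he₀ <| by
      rw [stressFree_zero.mp (h.stressFree hp hF) ω h0' hω]
      rfl)
    fun e he => (herase e he).lamanSparse hp
  obtain ⟨v, hv, h1, h3⟩ := exists_card_nbrs_le_three hF hcard.le
  have hsum := card_filter_add_card_nbrs C v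
  have hdeg : (nbrs C v).card = 3 := by
    by_contra h
    obtain ⟨u, hu⟩ := Finset.card_pos.mp h1
    exact (h0 _).mpr (mem_nbrs.mp hu)
      (hp.stress_eq_zero_of_card_nbrs_le_two hF h0' hω (by omega) u)
  obtain ⟨a, b, c, hab, hac, hbc, hN⟩ := Finset.card_eq_three.mp hdeg
  have hne : ∀ u ∈ nbrs C v, u ≠ v := fun u hu huv => hF _ (mem_nbrs.mp hu) (by simp [huv])
  have hW : ∀ u ∈ nbrs C v, u ∈ (vertices C).erase v := fun u hu =>
    Finset.mem_erase.mpr ⟨hne u hu, mem_vertices.mpr ⟨_, mem_nbrs.mp hu, by simp⟩⟩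
  have hva : s(v, a) ∈ C := mem_nbrs.mp (by simp [hN])
  have hLC : C.filter (v ∉ ·) ⊆ C := Finset.filter_subset _ _
  have hLv : ∀ e ∈ C.filter (v ∉ ·), v ∉ e := fun e he => (Finset.mem_filter.mp he).2
  have hL : StressFree p 0 (C.filter (v ∉ ·)) := (herase _ hva).mono fun e he =>
    Finset.mem_erase.mpr ⟨fun h => hLv e he (by simp [h]), hLC he⟩
  have hLW : C.filter (v ∉ ·) ⊆ ((vertices C).erase v).sym2 := by
    intro e he
    rw [Finset.mem_sym2_iff]
    exact fun x hx => Finset.mem_erase.mpr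
      ⟨fun h => hLv e he (h ▸ hx), mem_vertices.mpr ⟨e, hLC he, hx⟩⟩
  have hLcard : 2 * ((vertices C).erase v).card ≤ (C.filter (v ∉ ·)).card + 3 := by
    rw [Finset.card_erase_of_mem hv]
    omega
  by_cases hspoke : ∃ u, s(v, u) ∈ C ∧ χ s(v, u) ≠ 0
  · obtain ⟨u, hu, hχu⟩ := hspoke
    rw [← mem_nbrs, hN, Finset.mem_insert, Finset.mem_insert, Finset.mem_singleton] at hu
    obtain rfl | rfl | rfl := hu
    · exact StressFree.of_spoke hp hF hN hab hac hbc hL hχu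
    · exact StressFree.of_spoke hp hF (by rw [hN, Finset.insert_comm]) hab.symm hbc hac hL hχu
    · exact StressFree.of_spoke hp hF (by rw [hN, Finset.pair_comm b, Finset.insert_comm])
        hac.symm hbc.symm hab hL hχu
  push Not at hspoke
  have he₀L : e₀ ∈ C.filter (v ∉ ·) := by
    refine Finset.mem_filter.mpr ⟨he₀, ?_⟩
    rintro ⟨u, rfl⟩
    exact hχ (hspoke u he₀)
  have hchord : ∀ x y z, nbrs C v = {x, y, z} → x ≠ y → x ≠ z → y ≠ z → ∀ s : Sym2 V → ℝ,
      (∀ e ∉ C.filter (v ∉ ·), s e = 0) → force p (Pi.single s(x, y) 1) = force p s →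
      s e₀ ≠ 0 → StressFree p χ C := by
    intro x y z hN hxy hxz hyz s hs hforce hse₀
    refine StressFree.of_chord hp hF hN hxy hxz hyz hL hspoke hs hforce ?_
    by_cases hmem : s(x, y) ∈ C.filter (v ∉ ·)
    · have hsxy := hL.eq_of_force_eq (fun e he => Pi.single_eq_of_ne (by grind) _) hs hforce
      rw [← hsxy] at hse₀ ⊢
      have he : e₀ = s(x, y) := by
        by_contra h
        exact hse₀ (Pi.single_eq_of_ne h _)
      rw [Finset.sum_eq_single s(x, y) (fun e _ he => by simp [he]) (by simp)]
      simpa [← he] using hχ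
    intro hsum0
    set η : Sym2 V → ℝ := Pi.single s(x, y) 1 - s with hη
    have hηxy : η s(x, y) = 1 := by simp [hη, hs _ hmem]
    have hηne : ∀ e, e ≠ s(x, y) → η e = -s e := fun e he => by simp [hη, he]
    have hηforce : force p η = 0 := by rw [hη, map_sub, hforce, sub_self]
    have hη0 : ∀ e ∉ insert s(x, y) (C.filter (v ∉ ·)), η e = 0 := fun e he => by
      rw [Finset.mem_insert, not_or] at he
      rw [hηne e he.1, hs e he.2, neg_zero]
    have he₀xy : e₀ ≠ s(x, y) := fun h => hmem (h ▸ he₀L)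
    set D : Finset (Sym2 V) := Finset.univ.filter (η · ≠ 0) with hD
    have hmemD : ∀ e, η e ≠ 0 ↔ e ∈ D := fun e => by simp [hD]
    have hDL : D ⊆ insert s(x, y) (C.filter (v ∉ ·)) := fun e he => by
      by_contra h
      exact (hmemD e).mpr he (hη0 e h)
    have hDcard := (Finset.card_le_card hDL).trans (Finset.card_insert_le _ _)
    have hDfree := ih D.card (by omega) (C := D) (ω := η) (χ := Function.update χ s(x, y) 0)
      (e₀ := e₀) (fun e he => ?_) hmemD hηforce (fun e he => ?_)
      ((hmemD _).mp (by rw [hηne _ he₀xy]; simpa using hse₀))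
      (by rwa [Function.update_of_ne he₀xy]) rfl
    · have hzero := hDfree η (fun e he => by simpa [he] using hmemD e) hηforce (by
        rw [← neg_eq_zero, ← hsum0, ← Finset.sum_neg_distrib]
        refine Finset.sum_congr rfl fun e _ => ?_
        by_cases he : e = s(x, y)
        · rw [he, hs _ hmem]
          simp
        · rw [Function.update_of_ne he, hηne e he]
          ring)
      rw [hzero] at hηxy
      exact zero_ne_one hηxy
    · obtain rfl | he := Finset.mem_insert.mp (hDL he)
      · simpa using hxy
      · exact hF e (hLC he)
    · exact hL.erase_support hη0 (by simp [hηxy]) hηforce ((hmemD e).mpr he)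
  have hex : ∀ x ∈ nbrs C v, ∀ y ∈ nbrs C v, x ≠ y → ∃ s : Sym2 V → ℝ,
      (∀ e ∉ C.filter (v ∉ ·), s e = 0) ∧ force p (Pi.single s(x, y) 1) = force p s :=
    fun x hx y hy hxy => hL.exists_chord_stress hp hLW hLcard hxy (hW x hx) (hW y hy)
  obtain ⟨s, hs, hsf⟩ := hex a (by simp [hN]) b (by simp [hN]) hab
  obtain ⟨t, ht, htf⟩ := hex b (by simp [hN]) c (by simp [hN]) hbc
  obtain ⟨r, hr, hrf⟩ := hex a (by simp [hN]) c (by simp [hN]) hac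
  by_cases hse : s e₀ ≠ 0
  · exact hchord a b c hN hab hac hbc s hs hsf hse
  by_cases hte : t e₀ ≠ 0
  · exact hchord b c a (by rw [hN, Finset.insert_comm, Finset.pair_comm a c]) hbc
      hab.symm hac.symm t ht htf hte
  by_cases hre : r e₀ ≠ 0
  · exact hchord a c b (by rw [hN, Finset.pair_comm b c]) hac hab hbc.symm r hr hrf hre
  push Not at hse hte hre
  exfalso
  obtain ⟨x, y, z, hxyz⟩ := hp.exists_triangle_stress hab hac hbc
    (hne a (by simp [hN])) (hne b (by simp [hN])) (hne c (by simp [hN]))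
    (fun u hua hub huc => h0' _ fun hu => by
      rw [← mem_nbrs, hN] at hu
      simp [hua, hub, huc] at hu) hω
  have hzero : awayFrom v ω + x • s + y • t + z • r = 0 := by
    refine stressFree_zero.mp hL _ (fun e he => ?_) ?_
    · simp [awayFrom_eq_zero_of_notMem h0' he, hs e he, ht e he, hr e he]
    · rw [← hxyz]
      simp only [map_add, map_smul, hsf, htf, hrf]
  have := congrFun hzero e₀
  simp only [Pi.add_apply, Pi.smul_apply, hse, hte, hre, smul_zero, add_zero, awayFrom,
    hLv e₀ he₀L, if_false, Pi.zero_apply] at this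
  exact (h0 e₀).mpr he₀ this

section Coordinated

variable {c : Sym2 V → Option (Fin 1)} {p : Cfg V 2} {G : SimpleGraph V} {E : Finset (Sym2 V)}

/-- The indicator of the colour class. -/
def colour (c : Sym2 V → Option (Fin 1)) (e : Sym2 V) : ℚ := if c e = some 0 then 1 else 0

lemma rRow_eq_force (p : Cfg V 2) (e : Sym2 V) (v : V) (k : Fin 2) :
    rRow p e (v, k) = force (fun v k => p v k) (Pi.single e 1) v k := by
  induction e using Sym2.ind with
  | _ a b =>
  by_cases hab : a = b
  · subst hab
    rw [force_apply]
    simp only [rRow, Sym2.lift_mk, sub_self, ite_self, add_zero]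
    refine (Finset.sum_eq_zero fun u _ => ?_).symm
    by_cases h : v = a ∧ u = a
    · simp [h]
    · rw [Pi.single_eq_of_ne, zero_mul]
      simpa using h
  · rw [force_single _ hab]
    rfl

lemma sum_mul_rRow (p : Cfg V 2) (ω : Sym2 V → ℝ) (v : V) (k : Fin 2) :
    ∑ e, ω e * rRow p e (v, k) = force (fun v k => p v k) ω v k := by
  have h : ω = ∑ e, ω e • Pi.single e (1 : ℝ) := by
    simp [← Pi.single_smul, Finset.univ_sum_single]
  conv_rhs => rw [h, map_sum]
  simp [rRow_eq_force]

lemma sum_mul_coordRow_inl {ω : Sym2 V → ℝ} (hω : ∀ e ∉ E, ω e = 0) (v : V) (k : Fin 2) :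
    ∑ e ∈ E, ω e * coordRow c p e (Sum.inl (v, k)) = force (fun v k => p v k) ω v k := by
  rw [← sum_mul_rRow]
  exact Finset.sum_subset (Finset.subset_univ _) fun e _ he => by simp [hω e he]

lemma sum_mul_coordRow_inr {ω : Sym2 V → ℝ} (hω : ∀ e ∉ E, ω e = 0) :
    ∑ e ∈ E, ω e * coordRow c p e (Sum.inr 0) = ∑ e, (colour c e : ℝ) * ω e := by
  refine (Finset.sum_subset (Finset.subset_univ _) fun e _ he => by simp [hω e he]).trans ?_
  refine Finset.sum_congr rfl fun e _ => ?_
  by_cases hc : c e = some 0 <;> simp [coordRow, colour, hc]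

lemma linearIndepOn_coordRow_iff :
    LinearIndepOn ℝ (coordRow c p) (E : Set (Sym2 V)) ↔
      StressFree (fun v k => p v k) (colour c) E := by
  rw [linearIndepOn_finset_iff]
  constructor
  · intro h ω h0 hω hsum
    funext e
    by_cases he : e ∈ E
    · refine h ω ?_ e he
      funext x
      simp only [Finset.sum_apply, Pi.smul_apply, smul_eq_mul, Pi.zero_apply]
      obtain ⟨v, k⟩ | i := x
      · rw [sum_mul_coordRow_inl h0, hω]
        rfl
      · rw [Subsingleton.elim i 0, sum_mul_coordRow_inr h0, hsum]
    · exact h0 e he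
  · intro h f hf
    let ω : Sym2 V → ℝ := fun e => if e ∈ E then f e else 0
    have h0 : ∀ e ∉ E, ω e = 0 := fun e he => if_neg he
    have hE : ∀ e ∈ E, ω e = f e := fun e he => if_pos he
    have hx : ∀ x, ∑ e ∈ E, ω e * coordRow c p e x = 0 := fun x => by
      have := congrFun hf x
      simp only [Finset.sum_apply, Pi.smul_apply, smul_eq_mul, Pi.zero_apply] at this
      rw [← this]
      exact Finset.sum_congr rfl fun e he => by rw [hE e he]
    have hω : ω = 0 := h ω h0
      (by
        funext v k
        rw [← sum_mul_coordRow_inl (c := c) h0, hx]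
        rfl)
      (by rw [← sum_mul_coordRow_inr (p := p) h0, hx])
    intro e he
    rw [← hE e he, hω]
    rfl

lemma sum_coordRow_mul (p p' : Cfg V 2) (r' : Fin 1 → ℝ) (i j : V) :
    ∑ x, coordRow c p s(i, j) x * Sum.elim (fun vk : V × Fin 2 => p' vk.1 vk.2) r' x =
      ⟪p j - p i, p' j - p' i⟫ + if c s(i, j) = some 0 then r' 0 else 0 := by
  simp only [coordRow, rRow, Sym2.lift_mk, Fintype.sum_sum_type, Sum.elim_inl, Sum.elim_inr,
    Fintype.sum_prod_type_right, add_mul, ite_mul, zero_mul, Finset.sum_add_distrib,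
    Finset.sum_ite_eq', Finset.mem_univ, if_true, PiLp.inner_apply, Fin.sum_univ_two,
    Finset.univ_unique, Finset.sum_singleton, Fin.default_eq_zero, one_mul]
  simp
  ring

lemma isCoordInfMotion_iff {p' : Cfg V 2} {r' : Fin 1 → ℝ} :
    IsCoordInfMotion G c p p' r' ↔ ∀ e ∈ G.edgeSet,
      ∑ x, coordRow c p e x * Sum.elim (fun vk : V × Fin 2 => p' vk.1 vk.2) r' x = 0 := by
  constructor
  · rintro ⟨h1, h2⟩ e he
    induction e using Sym2.ind with
    | _ i j =>
    rw [sum_coordRow_mul]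
    by_cases hc : c s(i, j) = some 0
    · rw [if_pos hc, h2 i j 0 he hc]
    · rw [if_neg hc, add_zero]
      refine h1 i j he ?_
      cases hcc : c s(i, j) with
      | none => rfl
      | some l => exact absurd (by rw [hcc, Subsingleton.elim l 0]) hc
  · intro h
    constructor
    · intro i j hij hc
      have := h s(i, j) hij
      rwa [sum_coordRow_mul, hc, if_neg (by simp), add_zero] at this
    · intro i j l hij hc
      rw [Subsingleton.elim l 0] at hc ⊢
      have := h s(i, j) hij
      rwa [sum_coordRow_mul, if_pos hc] at this

/-- The coordinated rigidity matrix, with three additional rows that pin `a` and the second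
coordinate of `b`. -/
noncomputable def pinnedMatrix (c : Sym2 V → Option (Fin 1)) (p : Cfg V 2) (E : Finset (Sym2 V))
    (a b : V) : Matrix (E ⊕ Fin 3) ((V × Fin 2) ⊕ Fin 1) ℝ :=
  Matrix.of <| Sum.elim (fun e => coordRow c p e)
    fun i => Pi.single (Sum.inl (![(a, 0), (a, 1), (b, 1)] i)) 1

lemma pinnedMatrix_mulVec_eq_zero {a b : V} {x : (V × Fin 2) ⊕ Fin 1 → ℝ} :
    (pinnedMatrix c p E a b).mulVec x = 0 ↔ (∀ e ∈ E, ∑ i, coordRow c p e i * x i = 0) ∧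
      x (Sum.inl (a, 0)) = 0 ∧ x (Sum.inl (a, 1)) = 0 ∧ x (Sum.inl (b, 1)) = 0 := by
  have h : ∀ i : Fin 3, (pinnedMatrix c p E a b).mulVec x (Sum.inr i) =
      x (Sum.inl (![(a, 0), (a, 1), (b, 1)] i)) := fun i => single_one_dotProduct _ _
  rw [funext_iff, Sum.forall]
  refine and_congr Subtype.forall ?_
  simp [h, Fin.forall_fin_succ]

lemma injective_pinnedMatrix_mulVec (hE : (E : Set (Sym2 V)) = G.edgeSet) {a b : V}
    (hab : p a 0 ≠ p b 0) (h : CoordInfRigid G c p) :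
    Function.Injective (pinnedMatrix c p E a b).mulVecLin := by
  rw [injective_iff_map_eq_zero]
  intro x hx
  obtain ⟨h1, ha0, ha1, hb1⟩ := pinnedMatrix_mulVec_eq_zero.mp hx
  let p' : Cfg V 2 := fun v => WithLp.toLp 2 fun k => x (Sum.inl (v, k))
  have hxp : Sum.elim (fun vk : V × Fin 2 => p' vk.1 vk.2) (fun i => x (Sum.inr i)) = x := by
    funext i
    cases i <;> rfl
  obtain ⟨hr, S, t, hS, hp'⟩ := h p' (fun i => x (Sum.inr i)) (isCoordInfMotion_iff.mpr
    fun e he => by rw [hxp]; exact h1 e (by rwa [← Finset.mem_coe, hE]))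
  have hS' : ∀ i j, S j i = -S i j := fun i j => congrFun (congrFun hS i) j
  have h00 := hS' 0 0
  have h11 := hS' 1 1
  have h10 := hS' 0 1
  have hx' : ∀ v i, x (Sum.inl (v, i)) = S i 0 * p v 0 + S i 1 * p v 1 + t i := fun v i => by
    simpa [Fin.sum_univ_two] using hp' v i
  have h11 : S 1 1 = 0 := by linarith
  have h00 : S 0 0 = 0 := by linarith
  have h10' : S 1 0 = 0 := by
    rw [hx'] at ha1 hb1
    have : S 1 0 * (p a 0 - p b 0) = 0 := by
      linear_combination ha1 - hb1 - (p a 1 - p b 1) * h11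
    exact (mul_eq_zero.mp this).resolve_right (sub_ne_zero.mpr hab)
  have h01 : S 0 1 = 0 := by linarith
  have ht0 : t 0 = 0 := by
    rw [hx'] at ha0
    simpa [h00, h01] using ha0
  have ht1 : t 1 = 0 := by
    rw [hx'] at ha1
    simpa [h11, h10'] using ha1
  funext i
  obtain ⟨v, i⟩ | i := i
  · fin_cases i
    · simpa [h00, h01, ht0] using hx' v 0
    · simpa [h11, h10', ht1] using hx' v 1
  · exact congrFun hr i

lemma coordInfRigid_of_injective (hE : (E : Set (Sym2 V)) = G.edgeSet) {a b : V}
    (hab : p a 0 ≠ p b 0) (h : Function.Injective (pinnedMatrix c p E a b).mulVecLin) :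
    CoordInfRigid G c p := by
  intro p' r' hp'
  rw [injective_iff_map_eq_zero] at h
  have hd : p b 0 - p a 0 ≠ 0 := sub_ne_zero.mpr hab.symm
  set s : ℝ := (p' b 1 - p' a 1) / (p b 0 - p a 0) with hs
  set q : Cfg V 2 := fun v => WithLp.toLp 2
    ![p' v 0 - p' a 0 + s * (p v 1 - p a 1), p' v 1 - p' a 1 - s * (p v 0 - p a 0)] with hq
  have hmot : IsCoordInfMotion G c p q r' := by
    have hinner : ∀ i j, ⟪p j - p i, q j - q i⟫ = ⟪p j - p i, p' j - p' i⟫ := fun i j => by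
      simp [PiLp.inner_apply, Fin.sum_univ_two, hq]
      ring
    simpa only [IsCoordInfMotion, hinner] using hp'
  have hzero := h (Sum.elim (fun vk : V × Fin 2 => q vk.1 vk.2) r')
    (pinnedMatrix_mulVec_eq_zero.mpr ⟨fun e he => isCoordInfMotion_iff.mp hmot e
      (by rwa [← hE, Finset.mem_coe]), by simp [hq], by simp [hq], by
        simp only [hq, Sum.elim_inl, Matrix.cons_val_one, Matrix.cons_val_zero, hs]
        field_simp
        ring⟩)
  refine ⟨funext fun i => congrFun hzero (Sum.inr i), !![0, -s; s, 0],
    ![p' a 0 + s * p a 1, p' a 1 - s * p a 0], ?_, fun v i => ?_⟩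
  · ext i j
    fin_cases i <;> fin_cases j <;> simp
  · have := congrFun hzero (Sum.inl (v, i))
    fin_cases i <;> simp [hq, Fin.sum_univ_two] at this ⊢ <;> linear_combination this

lemma StressFree.injective_pinnedMatrix_vecMul {a b : V} (hab : p a 0 ≠ p b 0)
    (h : StressFree (fun v k => p v k) (colour c) E) :
    Function.Injective (pinnedMatrix c p E a b).vecMulLinear := by
  rw [injective_iff_map_eq_zero]
  intro y hy
  let ω : Sym2 V → ℝ := fun e => if he : e ∈ E then y (Sum.inl ⟨e, he⟩) else 0
  have h0 : ∀ e ∉ E, ω e = 0 := fun e he => dif_neg he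
  have hsum : ∀ x, ∑ e ∈ E, ω e * coordRow c p e x +
      (y (Sum.inr 0) * (Pi.single (Sum.inl (a, 0)) 1 : (V × Fin 2) ⊕ Fin 1 → ℝ) x +
      y (Sum.inr 1) * (Pi.single (Sum.inl (a, 1)) 1 : (V × Fin 2) ⊕ Fin 1 → ℝ) x +
      y (Sum.inr 2) * (Pi.single (Sum.inl (b, 1)) 1 : (V × Fin 2) ⊕ Fin 1 → ℝ) x) = 0 := by
    intro x
    have := congrFun hy x
    simp only [Matrix.vecMulLinear_apply, Matrix.vecMul, dotProduct, Fintype.sum_sum_type,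
      Fin.sum_univ_three, Pi.zero_apply] at this
    rw [← this, ← Finset.sum_coe_sort]
    congr 1
    refine Finset.sum_congr rfl fun e _ => ?_
    simp [ω, pinnedMatrix]
  have hω : ω = 0 := by
    refine h ω h0 (force_eq_zero_of_pinned hab fun v k hvk => ?_) ?_
    · have := hsum (Sum.inl (v, k))
      rw [sum_mul_coordRow_inl h0] at this
      simpa [Pi.single_apply, show v ≠ a by tauto, show ¬(v = b ∧ k = 1) by tauto] using this
    · have := hsum (Sum.inr 0)
      rw [sum_mul_coordRow_inr h0] at this
      simpa using this
  have hne : a ≠ b := fun h => hab (by rw [h])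
  simp only [hω, Pi.zero_apply, zero_mul, Finset.sum_const_zero, zero_add] at hsum
  funext i
  obtain ⟨e, he⟩ | i := i
  · simpa [ω, he] using congrFun hω e
  · fin_cases i
    · simpa using hsum (Sum.inl (a, 0))
    · simpa [hne] using hsum (Sum.inl (a, 1))
    · simpa [hne.symm] using hsum (Sum.inl (b, 1))

lemma StressFree.coordInfRigid (hE : (E : Set (Sym2 V)) = G.edgeSet) {a b : V}
    (hab : p a 0 ≠ p b 0) (h : StressFree (fun v k => p v k) (colour c) E)
    (hcard : E.card + 2 = 2 * Fintype.card V) : CoordInfRigid G c p := by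
  refine coordInfRigid_of_injective hE hab ?_
  have hsurj := (LinearMap.injective_iff_surjective_of_finrank_eq_finrank (by
    simp only [Module.finrank_fintype_fun_eq_card, Fintype.card_sum, Fintype.card_prod,
      Fintype.card_coe, Fintype.card_fin]
    omega)).mp (h.injective_pinnedMatrix_vecMul hab)
  rw [injective_iff_map_eq_zero]
  intro x hx
  obtain ⟨y, rfl⟩ := hsurj x
  have := Matrix.dotProduct_mulVec y (pinnedMatrix c p E a b)
    ((pinnedMatrix c p E a b).vecMulLinear y)
  rw [← Matrix.mulVecLin_apply, hx, dotProduct_zero] at this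
  exact dotProduct_self_eq_zero.mp this.symm

lemma card_add_two_le_of_coordInfRigid (hE : (E : Set (Sym2 V)) = G.edgeSet) {a b : V}
    (hab : p a 0 ≠ p b 0) (h : CoordInfRigid G c p) : 2 * Fintype.card V ≤ E.card + 2 := by
  have := LinearMap.finrank_le_finrank_of_injective (injective_pinnedMatrix_mulVec hE hab h)
  simp only [Module.finrank_fintype_fun_eq_card, Fintype.card_sum, Fintype.card_prod,
    Fintype.card_coe, Fintype.card_fin] at this
  omega

end Coordinated

section LamanSets

variable {V : Type*} [DecidableEq V] {F : Finset (Sym2 V)}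

lemma support_coe (F : Finset (Sym2 V)) : support (F : Set (Sym2 V)) = vertices F := by
  ext v
  simp [support, mem_vertices]

lemma edgesWithin_coe (F : Finset (Sym2 V)) (W : Finset V) :
    edgesWithin (F : Set (Sym2 V)) W = ↑(F ∩ W.sym2) := by
  ext e
  simp only [edgesWithin, Set.mem_ofPred_eq, Finset.mem_coe, Finset.mem_inter,
    Finset.mem_sym2_iff]

lemma LamanSparse.lamanSparseOn [Fintype V] (h : LamanSparse F) (W : Set V) :
    LamanSparseOn W (F : Set (Sym2 V)) := by
  intro W' _ h2
  obtain ⟨W', rfl⟩ := W'.toFinite.exists_finset_coe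
  rw [Set.ncard_coe_finset] at h2 ⊢
  rw [edgesWithin_coe, Set.ncard_coe_finset]
  have := h W' h2
  omega

lemma LamanSparseOn.lamanSparse {W : Set V} (hF : ∀ e ∈ F, ¬e.IsDiag)
    (hW : support (F : Set (Sym2 V)) ⊆ W) (h : LamanSparseOn W (F : Set (Sym2 V))) :
    LamanSparse F := by
  intro W' h2
  have heq : F ∩ W'.sym2 = F ∩ (W' ∩ vertices F).sym2 := by
    ext e
    simp only [Finset.mem_inter, Finset.mem_sym2_iff, mem_vertices]
    exact ⟨fun he => ⟨he.1, fun v hv => ⟨he.2 v hv, e, he.1, hv⟩⟩,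
      fun he => ⟨he.1, fun v hv => (he.2 v hv).1⟩⟩
  have hle : (W' ∩ vertices F).card ≤ W'.card := Finset.card_le_card Finset.inter_subset_left
  rw [heq]
  by_cases hc : (W' ∩ vertices F).card ≤ 1
  · rw [inter_sym2_eq_empty_of_card_le_one hF hc, Finset.card_empty]
    omega
  · have := h ↑(W' ∩ vertices F)
      (fun v hv => hW (by rw [support_coe]; exact (Finset.mem_inter.mp hv).2))
      (by rw [Set.ncard_coe_finset]; omega)
    rw [edgesWithin_coe, Set.ncard_coe_finset, Set.ncard_coe_finset] at this
    omega

end LamanSets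

/-- If every nonzero stress on `F` has nonzero weight, then the stresses on `F` are proportional,
so deleting an edge in the support of one of them leaves no stress. -/
lemma StressFree.erase {p : V → Fin 2 → ℝ} {χ : Sym2 V → ℚ} {F : Finset (Sym2 V)}
    (h : StressFree p χ F) {ω : Sym2 V → ℝ} (h0 : ∀ e ∉ F, ω e = 0) (hω : force p ω = 0)
    {f : Sym2 V} (hf : ω f ≠ 0) : StressFree p 0 (F.erase f) := by
  have hχ : ∑ e, (χ e : ℝ) * ω e ≠ 0 := fun hχ => hf (by rw [h ω h0 hω hχ]; rfl)
  set m := ∑ e, (χ e : ℝ) * ω e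
  rw [stressFree_zero]
  intro ν hν0 hν
  set l := ∑ e, (χ e : ℝ) * ν e with hl
  have hzero := h (ν - (l / m) • ω)
    (fun e he => by simp [h0 e he, hν0 e (fun h => he (Finset.mem_of_mem_erase h))])
    (by rw [map_sub, map_smul, hν, hω, smul_zero, sub_zero])
    (by
      simp only [Pi.sub_apply, Pi.smul_apply, smul_eq_mul, mul_sub, Finset.sum_sub_distrib,
        mul_left_comm _ (l / m), ← Finset.mul_sum]
      rw [div_mul_cancel₀ _ hχ, sub_self])
  have := congrFun hzero f
  simp only [Pi.sub_apply, hν0 f (Finset.notMem_erase f F), Pi.smul_apply, smul_eq_mul, zero_sub,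
    Pi.zero_apply, neg_eq_zero] at this
  simpa [(mul_eq_zero.mp this).resolve_right hf] using hzero

lemma StressFree.of_erase {p : V → Fin 2 → ℝ} {χ : Sym2 V → ℚ} {C F : Finset (Sym2 V)}
    (hCF : C ⊆ F) (hC : StressFree p χ C) {ω : Sym2 V → ℝ} (h0 : ∀ e ∉ C, ω e = 0)
    (hω : force p ω = 0) {f : Sym2 V} (hf : ω f ≠ 0) (hF : StressFree p 0 (F.erase f)) :
    StressFree p χ F := by
  intro ν hν0 hν hsum
  have hzero : ν - (ν f / ω f) • ω = 0 := by
    refine stressFree_zero.mp hF _ (fun e he => ?_) ?_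
    · by_cases hef : e = f
      · simp [hef, hf]
      · have heF : e ∉ F := fun h => he (Finset.mem_erase.mpr ⟨hef, h⟩)
        simp [hν0 e heF, h0 e fun h => heF (hCF h)]
    · rw [map_sub, map_smul, hν, hω, smul_zero, sub_zero]
  refine hC ν (fun e he => ?_) hν hsum
  rw [sub_eq_zero.mp hzero]
  simp [h0 e he]

/-- A circuit carries a stress that vanishes on none of its edges. -/
lemma exists_stress_of_circuit {p : V → Fin 2 → ℝ} (hp : GenericPlane p) {C : Finset (Sym2 V)}
    (hC : ¬LamanSparse C) (h : ∀ e ∈ C, StressFree p 0 (C.erase e)) :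
    ∃ ω : Sym2 V → ℝ, (∀ e, ω e ≠ 0 ↔ e ∈ C) ∧ force p ω = 0 := by
  have hnot := mt (StressFree.lamanSparse hp) hC
  rw [stressFree_zero] at hnot
  push Not at hnot
  obtain ⟨ω, h0, hω, hne⟩ := hnot
  refine ⟨ω, fun e => ⟨fun he => by_contra fun h => he (h0 e h), fun he hz => hne ?_⟩, hω⟩
  refine stressFree_zero.mp (h e he) ω (fun f hf => ?_) hω
  by_cases hfe : f = e
  · rw [hfe, hz]
  · exact h0 f fun h => hf (Finset.mem_erase.mpr ⟨hfe, h⟩)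

omit [Fintype V] [DecidableEq V] in
lemma not_isDiag_of_coe_subset {G : SimpleGraph V} {F : Finset (Sym2 V)}
    (hF : (F : Set (Sym2 V)) ⊆ G.edgeSet) : ∀ e ∈ F, ¬e.IsDiag :=
  fun _ he => G.not_isDiag_of_mem_edgeSet (hF he)

end PlaneStresses

/-- A `1`-coloured graph `(G,c)` is generically isostatic in dimension `2` iff `G` is a
Laman+1 graph and at least one edge of the colour class `E_1` lies in the (unique)
Laman-circuit subgraph of `G`. -/
theorem one_class_isostatic_iff {V : Type*} [Fintype V] [DecidableEq V]
    (G : SimpleGraph V) (c : Sym2 V → Option (Fin 1))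
    (hc : ∃ e ∈ G.edgeSet, c e = some 0) :
    GenericallyIsostaticCoord 2 G c ↔
      (IsLamanPlusOne G ∧
        ∃ C ⊆ G.edgeSet, IsLamanCircuitOn (support C) C ∧ ∃ e ∈ C, c e = some 0) := by
  obtain ⟨e₀, he₀, hce₀⟩ := hc
  obtain ⟨E, hE⟩ := G.edgeSet.toFinite.exists_finset_coe
  have hdiag := not_isDiag_of_coe_subset hE.subset
  obtain ⟨a, b⟩ := e₀
  have hab : a ≠ b := G.ne_of_adj he₀
  have hn : 2 ≤ Fintype.card V := Fintype.one_lt_card_iff.mpr ⟨a, b, hab⟩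
  constructor
  · intro h
    obtain ⟨q, hq⟩ := exists_genericPlane (V := V)
    let p : Cfg V 2 := fun v => WithLp.toLp 2 (q v)
    obtain ⟨hlin, hrig⟩ := h p hq
    have hle := card_add_two_le_of_coordInfRigid hE (hq.injective hab 0) hrig
    change LinearIndepOn ℝ (coordRow c p) G.edgeSet at hlin
    rw [← hE, linearIndepOn_coordRow_iff] at hlin
    change StressFree q (colour c) E at hlin
    have huniv : ∀ F : Finset (Sym2 V), LamanSparse F → F.card + 3 ≤ 2 * Fintype.card V := by
      intro F hF
      have := hF Finset.univ hn
      rwa [Finset.sym2_univ, Finset.inter_univ, Finset.card_univ] at this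
    have hnot : ¬StressFree q 0 E := fun hfree => by
      have := huniv E (hfree.lamanSparse hq)
      omega
    rw [stressFree_zero] at hnot
    push Not at hnot
    obtain ⟨ω, h0, hω, hne⟩ := hnot
    set D : Finset (Sym2 V) := Finset.univ.filter (ω · ≠ 0) with hD
    have hmemD : ∀ e, e ∈ D ↔ ω e ≠ 0 := fun e => by simp [hD]
    have hDE : D ⊆ E := fun e he => by
      by_contra hn
      exact (hmemD e).mp he (h0 e hn)
    have herase : ∀ f ∈ D, LamanSparse (E.erase f) := fun f hf =>
      (hlin.erase h0 hω ((hmemD f).mp hf)).lamanSparse hq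
    obtain ⟨e, -, he⟩ := Finset.exists_ne_zero_of_sum_ne_zero
      (mt (hlin ω h0 hω) hne)
    have heD : e ∈ D := (hmemD e).mpr (right_ne_zero_of_mul he)
    have hce : c e = some 0 := by
      by_contra hce
      simp [colour, hce] at he
    have hcardE := huniv _ (herase e heD)
    rw [Finset.card_erase_of_mem (hDE heD)] at hcardE
    have hDdiag : ∀ e ∈ D, ¬e.IsDiag := fun e he => hdiag e (hDE he)
    have hDerase : ∀ f ∈ D, LamanSparse (D.erase f) := fun f hf =>
      (herase f hf).mono (Finset.erase_subset_erase f hDE)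
    have hDcard := card_add_two_eq_of_circuit hDdiag (fun hsp => hne <|
      stressFree_zero.mp (hsp.stressFree hq hDdiag) ω (fun f hf => by simpa [hmemD] using hf) hω)
      hDerase
    refine ⟨⟨?_, e, hE ▸ hDE heD, ?_, ?_⟩, D, hE ▸ hDE, ⟨?_, fun f hf => ⟨?_, ?_⟩⟩, e, heD, hce⟩
    · rw [← hE, Set.ncard_coe_finset]
      omega
    · rw [← hE, ← Finset.coe_erase]
      exact (herase e heD).lamanSparseOn _
    · rw [← hE, ← Finset.coe_erase, Set.ncard_coe_finset, Finset.card_erase_of_mem (hDE heD),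
        Set.ncard_univ, Nat.card_eq_fintype_card]
      omega
    · rw [support_coe, Set.ncard_coe_finset, Set.ncard_coe_finset]
      omega
    · rw [← Finset.coe_erase]
      exact (hDerase f hf).lamanSparseOn _
    · rw [← Finset.coe_erase, support_coe, Set.ncard_coe_finset, Set.ncard_coe_finset,
        Finset.card_erase_of_mem hf]
      omega
  · rintro ⟨⟨hcard, f, hf, hsp, -⟩, C, hCE, ⟨hCcard, hCerase⟩, e, he, hce⟩ p hp
    obtain ⟨C, rfl⟩ := C.toFinite.exists_finset_coe
    have hp' : GenericPlane fun v k => p v k := hp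
    rw [← hE] at hcard hCE hsp
    rw [Set.ncard_coe_finset] at hcard
    rw [support_coe, Set.ncard_coe_finset, Set.ncard_coe_finset] at hCcard
    rw [← Finset.coe_erase] at hsp
    rw [Finset.coe_subset] at hCE
    have hCdiag : ∀ e ∈ C, ¬e.IsDiag := fun e he => hdiag e (hCE he)
    have hEf : LamanSparse (E.erase f) := hsp.lamanSparse
      (fun e he => hdiag e (Finset.mem_of_mem_erase he)) (Set.subset_univ _)
    have hC : ¬LamanSparse C := fun hC => by
      have := hC.card_add_three_le hCdiag ⟨e, he⟩
      omega
    have hCfree : ∀ g ∈ C, StressFree (fun v k => p v k) 0 (C.erase g) := fun g hg => by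
      have hgdiag : ∀ e ∈ C.erase g, ¬e.IsDiag := fun e he =>
        hCdiag e (Finset.mem_of_mem_erase he)
      have hgsp := (hCerase g hg).1
      rw [← Finset.coe_erase] at hgsp
      refine (hgsp.lamanSparse hgdiag ?_).stressFree hp' hgdiag
      rintro v ⟨e, he, hv⟩
      exact ⟨e, Finset.mem_of_mem_erase he, hv⟩
    have hfC : f ∈ C := by
      by_contra hfC
      exact hC (hEf.mono fun g hg => Finset.mem_erase.mpr ⟨fun h => hfC (h ▸ hg), hCE hg⟩)
    obtain ⟨ω, h0, hω⟩ := exists_stress_of_circuit hp' hC hCfree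
    have hCχ := hp'.stressFree_of_circuit hCdiag h0 hω hCfree (χ := colour c) he
      (by simp [colour, hce])
    have hEχ : StressFree (fun v k => p v k) (colour c) E :=
      hCχ.of_erase hCE (fun g hg => by simpa [hg] using h0 g) hω ((h0 f).mpr hfC)
        (hEf.stressFree hp' fun e he => hdiag e (Finset.mem_of_mem_erase he))
    refine ⟨?_, hEχ.coordInfRigid hE (hp'.injective hab 0) (by omega)⟩
    change LinearIndepOn ℝ (coordRow c p) G.edgeSet
    rwa [← hE, linearIndepOn_coordRow_iff]

end CoordRigidity
end

section
/- Let (G,c) be a 2-coloured graph such that G is a Laman+2 graph, neither colour class E_1 nor E_2 consists only of bridges of M_2(G), G_0 is Laman-sparse, and both G_1 and G_2 are (2,2)-sparse. Then two monochromatic circuits of the same colour i in (G,c) cannot share an edge; that is, if C and C' are distinct Laman-circuit subgraphs of G_i each containing at least one edge of E_i, then C and C' have no common edge. -/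
open scoped RealInnerProductSpace

namespace CoordRigidity

variable {V : Type*} [Fintype V] [DecidableEq V] {d k : ℕ}

theorem mem_edgesWithin_support {E' F : Set (Sym2 V)} {e : Sym2 V} {W : Set V}
    (he : e ∈ E') (heF : e ∈ F) (hW : support E' ⊆ W) : e ∈ edgesWithin F W :=
  ⟨heF, fun _ hv => hW ⟨e, he, hv⟩⟩

/-- Removing an edge of a Laman circuit that lies outside `D` shows that `C ∩ D` is Laman-sparse
on the common support. -/
theorem IsLamanCircuitOn.ncard_inter_le {C D : Set (Sym2 V)} {e : Sym2 V}
    (hC : IsLamanCircuitOn (support C) C) (he : e ∈ C) (heD : e ∉ D)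
    (h : 2 ≤ (support C ∩ support D).ncard) :
    (C ∩ D).ncard ≤ 2 * (support C ∩ support D).ncard - 3 := by
  refine le_trans (Set.ncard_le_ncard ?_ (Set.toFinite _))
    ((hC.2 e he).1 _ Set.inter_subset_left h)
  rintro f ⟨hfC, hfD⟩
  refine ⟨⟨hfC, ?_⟩, fun v hv => ⟨⟨f, hfC, hv⟩, ⟨f, hfD, hv⟩⟩⟩
  rintro rfl
  exact heD hfD

/-- Distinct Laman circuits in a loopless `(2,2)`-sparse edge set are edge-disjoint. -/
theorem Sparse22On.disjoint_of_isLamanCircuitOn {F C D : Set (Sym2 V)}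
    (hF : Sparse22On Set.univ F) (hloop : ∀ e ∈ F, ¬ e.IsDiag) (hCF : C ⊆ F) (hDF : D ⊆ F)
    (hC : IsLamanCircuitOn (support C) C) (hD : IsLamanCircuitOn (support D) D) (hne : C ≠ D) :
    Disjoint C D := by
  rw [Set.disjoint_left]
  intro f hfC hfD
  have hint : 2 ≤ (support C ∩ support D).ncard := by
    induction f with
    | _ a b =>
      have hab : a ≠ b := fun h => hloop _ (hCF hfC) (Sym2.mk_isDiag_iff.2 h)
      rw [← Set.ncard_pair hab]
      refine Set.ncard_le_ncard ?_ (Set.toFinite _)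
      rintro v (rfl | rfl)
      · exact ⟨⟨_, hfC, Sym2.mem_mk_left _ _⟩, ⟨_, hfD, Sym2.mem_mk_left _ _⟩⟩
      · exact ⟨⟨_, hfC, Sym2.mem_mk_right _ _⟩, ⟨_, hfD, Sym2.mem_mk_right _ _⟩⟩
  have hCle := Set.ncard_le_ncard (Set.inter_subset_left (s := support C) (t := support D))
    (Set.toFinite _)
  have hDle := Set.ncard_le_ncard (Set.inter_subset_right (s := support C) (t := support D))
    (Set.toFinite _)
  have hV := Set.ncard_union_add_ncard_inter (support C) (support D)
  have hE := Set.ncard_union_add_ncard_inter C D (Set.toFinite _) (Set.toFinite _)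
  have hunion : (C ∪ D).ncard ≤ 2 * (support C ∪ support D).ncard - 2 := by
    refine le_trans (Set.ncard_le_ncard ?_ (Set.toFinite _))
      (hF _ (Set.subset_univ _) (by omega))
    rintro e (he | he)
    · exact mem_edgesWithin_support he (hCF he) Set.subset_union_left
    · exact mem_edgesWithin_support he (hDF he) Set.subset_union_right
  have hinter : (C ∩ D).ncard ≤ 2 * (support C ∩ support D).ncard - 3 := by
    by_cases hCD : C ⊆ D
    · obtain ⟨e, heD, heC⟩ := Set.exists_of_ssubset (hCD.ssubset_of_ne hne)
      rw [Set.inter_comm C, Set.inter_comm (support C)] at *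
      exact hD.ncard_inter_le heD heC hint
    · obtain ⟨e, heC, heD⟩ := Set.not_subset.1 hCD
      exact hC.ncard_inter_le heC heD hint
  have hC1 := hC.1
  have hD1 := hD.1
  omega

/-- In a `2`-coloured graph satisfying the conditions of the Laman-type theorem for two
coordination classes (Laman+2, no colour class all bridges, `G_0` Laman-sparse, `G_1`
and `G_2` `(2,2)`-sparse), two distinct monochromatic Laman circuits of the same colour
cannot share an edge. -/
theorem monochromatic_circuits_edge_disjoint {V : Type*} [Fintype V] [DecidableEq V]
    (G : SimpleGraph V) (c : Sym2 V → Option (Fin 2))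
    (hc : ∀ i : Fin 2, ∃ e ∈ G.edgeSet, c e = some i)
    (h1 : IsLamanPlusTwo G)
    (h2 : ∀ i : Fin 2, ¬ ∀ e ∈ {e ∈ G.edgeSet | c e = some i}, ¬ RedundantSet 2 G {e})
    (h3 : LamanSparseOn Set.univ {e ∈ G.edgeSet | c e = none})
    (h4 : ∀ i : Fin 2, Sparse22On Set.univ {e ∈ G.edgeSet | c e = none ∨ c e = some i}) :
    ∀ i : Fin 2, ∀ C C' : Set (Sym2 V),
      C ⊆ {e ∈ G.edgeSet | c e = none ∨ c e = some i} →
      C' ⊆ {e ∈ G.edgeSet | c e = none ∨ c e = some i} →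
      IsLamanCircuitOn (support C) C → IsLamanCircuitOn (support C') C' →
      (∃ e ∈ C, c e = some i) → (∃ e ∈ C', c e = some i) →
      C ≠ C' → Disjoint C C' := by
  intro i C C' hCG hCG' hC hC' _ _ hne
  exact (h4 i).disjoint_of_isLamanCircuitOn
    (fun e he => G.not_isDiag_of_mem_edgeSet he.1) hCG hCG' hC hC' hne

end CoordRigidity
end
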